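/- arXiv:1705.07532 — 3 statements merged into one kernel-verified Lean document; each statement's English description precedes it below -/
import Mathlib

section
/- Suppose Assumptions 1 and 3 hold. Then global consensus is achieved for the system x(t+1) = A(t) x(t) if and only if the persistent graph G_p contains a directed spanning tree. -/
open Filter Finset

/-- Arc `(j,i)` is persistent: `∑_{t=0}^∞ a_ij(t) = ∞`, where `a_ij(t) = A t i j`. -/
def PersistentArc {N : ℕ} (A : ℕ → Matrix (Fin N) (Fin N) ℝ) (j i : Fin N) : Prop :=
  Tendsto (fun n => ∑ t ∈ Finset.range n, A t i j) atTop atTop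

/-- A directed graph (given by its arc relation) contains a directed spanning tree:
there is a root from which every node is reachable along directed paths. -/
def HasDirectedSpanningTree {N : ℕ} (arc : Fin N → Fin N → Prop) : Prop :=
  ∃ r : Fin N, ∀ i : Fin N, Relation.ReflTransGen arc r i

/-- The total weight of the arcs from the complement of `S` into `S`. -/
def cutWeight {ι : Type*} [Fintype ι] [DecidableEq ι] (B : Matrix ι ι ℝ) (S : Finset ι) : ℝ :=
  ∑ i ∈ S, ∑ j ∈ Sᶜ, B i j

lemma cutWeight_nonneg {ι : Type*} [Fintype ι] [DecidableEq ι] {B : Matrix ι ι ℝ}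
    (hB : ∀ i j, 0 ≤ B i j) (S : Finset ι) : 0 ≤ cutWeight B S :=
  sum_nonneg fun _ _ => sum_nonneg fun _ _ => hB _ _

lemma row_le_cutWeight {ι : Type*} [Fintype ι] [DecidableEq ι] {B : Matrix ι ι ℝ}
    (hB : ∀ i j, 0 ≤ B i j) {S : Finset ι} {i : ι} (hi : i ∈ S) :
    ∑ j ∈ Sᶜ, B i j ≤ cutWeight B S :=
  single_le_sum (f := fun i => ∑ j ∈ Sᶜ, B i j) (fun _ _ => sum_nonneg fun _ _ => hB _ _) hi

lemma cutWeight_le_card {ι : Type*} [Fintype ι] [DecidableEq ι] {B : Matrix ι ι ℝ}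
    (hB : ∀ i j, 0 ≤ B i j) (hrow : ∀ i, ∑ j, B i j = 1) (S : Finset ι) :
    cutWeight B S ≤ (#S : ℝ) := by
  have h : ∀ i ∈ S, ∑ j ∈ Sᶜ, B i j ≤ 1 := fun i _ => by
    rw [← hrow i]
    exact sum_le_sum_of_subset_of_nonneg (subset_univ _) fun _ _ _ => hB _ _
  simpa [cutWeight] using sum_le_sum h

/-- One step of a cut-balanced stochastic matrix applied to the indicator of `S`, measured with
weights that are much smaller on `S` than off `S`. -/
lemma indicator_weighted_gain {ι : Type*} [Fintype ι] [DecidableEq ι] {B : Matrix ι ι ℝ}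
    {η K ρ a c : ℝ} {S : Finset ι} {w : ι → ℝ} (hB : ∀ i j, 0 ≤ B i j)
    (hrow : ∀ i, ∑ j, B i j = 1) (hdiag : ∀ i, η ≤ B i i) (hη0 : 0 ≤ η) (hη1 : η ≤ 1)
    (hK : 0 ≤ K) (hbal : cutWeight B S ≤ K * cutWeight B Sᶜ) (ha : 0 ≤ a) (hρK : ρ * K ≤ 1 / 2)
    (hρ : 0 ≤ ρ)
    (hρN : ρ * Fintype.card ι ≤ η / 2) (hw : ∀ i, 0 ≤ w i) (hwS : ∀ i ∈ S, w i ≤ ρ * a)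
    (hwS' : ∀ i ∉ S, a ≤ w i) (hc : 0 ≤ c) (hca : 2 * c * (Fintype.card ι + K + 1) ≤ η * a)
    (π : Equiv.Perm ι) :
    ∑ i ∈ S, w i + c * (cutWeight B S + cutWeight B Sᶜ) ≤
      ∑ i, w (π i) * ∑ j ∈ S, B i j := by
  have hp := cutWeight_nonneg hB S
  have hq := cutWeight_nonneg hB Sᶜ
  have hcard : (#S : ℝ) + #Sᶜ = Fintype.card ι := by exact_mod_cast card_add_card_compl S
  have hn : (0 : ℝ) ≤ Fintype.card ι := Nat.cast_nonneg _
  by_cases hπ : ∀ i ∈ S, π i ∈ S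
  · have hmap : S.map π.toEmbedding = S := by
      refine eq_of_subset_of_card_le ?_ (by simp)
      intro i hi
      obtain ⟨j, hj, rfl⟩ := mem_map.1 hi
      exact hπ j hj
    have hπ' : ∀ i ∉ S, π i ∉ S := fun i hi h => by
      rw [← hmap] at h
      simp [hi] at h
    have hsum : ∑ i ∈ S, w (π i) = ∑ i ∈ S, w i := by
      conv_rhs => rw [← hmap]
      simp
    have hin : ∑ i ∈ S, w (π i) - ρ * a * cutWeight B S ≤
        ∑ i ∈ S, w (π i) * ∑ j ∈ S, B i j := by
      rw [cutWeight, mul_sum, ← sum_sub_distrib]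
      refine sum_le_sum fun i hi => ?_
      have h1 : ∑ j ∈ S, B i j = 1 - ∑ j ∈ Sᶜ, B i j := by
        rw [← hrow i, ← sum_add_sum_compl S]; ring
      have h2 : 0 ≤ ∑ j ∈ Sᶜ, B i j := sum_nonneg fun _ _ => hB _ _
      rw [h1]
      nlinarith [mul_le_mul_of_nonneg_right (hwS _ (hπ i hi)) h2]
    have hout : a * cutWeight B Sᶜ ≤ ∑ i ∈ Sᶜ, w (π i) * ∑ j ∈ S, B i j := by
      rw [cutWeight, mul_sum, compl_compl]
      refine sum_le_sum fun i hi => ?_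
      exact mul_le_mul_of_nonneg_right (hwS' _ (hπ' i (by simpa using hi)))
        (sum_nonneg fun _ _ => hB _ _)
    rw [← sum_add_sum_compl S]
    set p := cutWeight B S
    set q := cutWeight B Sᶜ
    have h1 : c * (p + q) ≤ c * ((K + 1) * q) := by gcongr; linarith
    have h2 : ρ * a * p ≤ ρ * a * (K * q) := by gcongr
    have h3 : ρ * K * (a * q) ≤ 1 / 2 * (a * q) := by gcongr
    have h4 : 2 * c * (Fintype.card ι + K + 1) * q ≤ η * a * q := by gcongr
    have h5 : η * (a * q) ≤ 1 * (a * q) := by gcongr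
    have h6 : 0 ≤ c * Fintype.card ι * q := by positivity
    linarith
  · push Not at hπ
    obtain ⟨i, hi, hiS⟩ := hπ
    have h1 : w (π i) * ∑ j ∈ S, B i j ≤ ∑ i, w (π i) * ∑ j ∈ S, B i j :=
      single_le_sum (f := fun i => w (π i) * ∑ j ∈ S, B i j)
        (fun _ _ => mul_nonneg (hw _) (sum_nonneg fun _ _ => hB _ _)) (mem_univ i)
    have h2 : η ≤ ∑ j ∈ S, B i j :=
      (hdiag i).trans (single_le_sum (f := fun j => B i j) (fun _ _ => hB _ _) hi)
    have h3 : a * η ≤ w (π i) * ∑ j ∈ S, B i j := mul_le_mul (hwS' _ hiS) h2 hη0 (hw _)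
    have h4 : ∑ i ∈ S, w i ≤ #S * (ρ * a) := by
      simpa using sum_le_sum hwS
    have h5 : (#S : ℝ) * (ρ * a) ≤ Fintype.card ι * (ρ * a) := by
      gcongr
      exact card_le_univ S
    have h6 : ρ * Fintype.card ι * a ≤ η / 2 * a := by gcongr
    have h7 : c * (cutWeight B S + cutWeight B Sᶜ) ≤ c * Fintype.card ι := by
      gcongr
      linarith [cutWeight_le_card hB hrow S, cutWeight_le_card hB hrow Sᶜ]
    have h8 : 0 ≤ c * (K + 1) := by positivity
    linarith

lemma linearMap_nonneg_of_monotone {n : ℕ} (F : (Fin (n + 1) → ℝ) →ₗ[ℝ] ℝ)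
    (hF1 : F (fun _ => 1) = 0)
    (hF : ∀ k : Fin n, 0 ≤ F (fun i => if k.castSucc < i then 1 else 0))
    {y : Fin (n + 1) → ℝ} (hy : Monotone y) : 0 ≤ F y := by
  have hdecomp : y = y 0 • (fun _ => 1) + ∑ k : Fin n, (y k.succ - y k.castSucc) •
      (fun i : Fin (n + 1) => if k.castSucc < i then (1 : ℝ) else 0) := by
    ext i
    simp only [Pi.add_apply, Pi.smul_apply, smul_eq_mul, mul_one, Finset.sum_apply]
    induction i using Fin.induction with
    | zero => simp
    | succ i ih =>
      have hstep : ∀ k : Fin n, (y k.succ - y k.castSucc) *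
          (if k.castSucc < i.succ then (1 : ℝ) else 0) =
          (y k.succ - y k.castSucc) * (if k.castSucc < i.castSucc then (1 : ℝ) else 0) +
          if k = i then y k.succ - y k.castSucc else 0 := by
        intro k
        rcases lt_trichotomy k i with h | h | h
        · have h1 : k.castSucc < i.succ := by
            rw [Fin.lt_def] at h ⊢
            simp only [Fin.val_castSucc, Fin.val_succ]
            omega
          simp [h1, h, h.ne]
        · subst h; simp
        · have h1 : ¬ k.castSucc < i.succ := by
            rw [Fin.lt_def] at h ⊢
            simp only [Fin.val_castSucc, Fin.val_succ]
            omega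
          simp [h1, h.le, h.ne']
      simp only [hstep, sum_add_distrib, sum_ite_eq', mem_univ, if_true]
      linarith
  rw [hdecomp, map_add, map_smul, hF1, map_sum]
  simp only [smul_zero, zero_add, map_smul]
  exact sum_nonneg fun k _ => mul_nonneg (sub_nonneg.2 (hy k.castSucc_lt_succ.le)) (hF k)

/-- The disagreement of `x` weighted by the entries of `B`. -/
def disagreement {ι : Type*} [Fintype ι] (B : Matrix ι ι ℝ) (x : ι → ℝ) : ℝ :=
  ∑ i, ∑ j, B i j * |x i - x j|

/-- The sorted weighted sum: the least value of a weighted sum of the entries of `x` over all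
assignments of the weights. -/
noncomputable def sortedSum {ι : Type*} [Fintype ι] [DecidableEq ι] (w x : ι → ℝ) : ℝ :=
  (univ : Finset (Equiv.Perm ι)).inf' univ_nonempty fun π => ∑ i, w (π i) * x i

lemma sorted_weighted_gain {n : ℕ} {B : Matrix (Fin (n + 1)) (Fin (n + 1)) ℝ}
    {η K ρ c : ℝ} (hB : ∀ i j, 0 ≤ B i j)
    (hrow : ∀ i, ∑ j, B i j = 1) (hdiag : ∀ i, η ≤ B i i) (hη0 : 0 ≤ η) (hη1 : η ≤ 1)
    (hK : 0 ≤ K) (hbal : ∀ S, S.Nonempty → S ≠ univ → cutWeight B S ≤ K * cutWeight B Sᶜ)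
    (hρ0 : 0 ≤ ρ) (hρ1 : ρ ≤ 1) (hρK : ρ * K ≤ 1 / 2)
    (hρN : ρ * (n + 1 : ℕ) ≤ η / 2)
    (hc : 0 ≤ c) (hca : 2 * c * ((n + 1 : ℕ) + K + 1) ≤ η * ρ ^ n)
    (π : Equiv.Perm (Fin (n + 1))) {y : Fin (n + 1) → ℝ} (hy : Monotone y) :
    ∑ i : Fin (n + 1), ρ ^ (i : ℕ) * y i + c * disagreement B y ≤
      ∑ i, ρ ^ (π i : ℕ) * ∑ j, B i j * y j := by
  let F : (Fin (n + 1) → ℝ) →ₗ[ℝ] ℝ :=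
    { toFun := fun y => ∑ i, ρ ^ (π i : ℕ) * ∑ j, B i j * y j -
        ∑ i : Fin (n + 1), ρ ^ (i : ℕ) * y i -
        c * ∑ i, ∑ j, B i j * (y (max i j) - y (min i j))
      map_add' := fun y z => by
        simp only [Pi.add_apply, mul_add, mul_sub, sum_add_distrib, sum_sub_distrib]
        ring
      map_smul' := fun r y => by
        simp only [Pi.smul_apply, smul_eq_mul, RingHom.id_apply, mul_sub, mul_sum]
        congr 1
        · congr 1 <;> simp only [mul_left_comm r]
        · simp only [← mul_sub, mul_left_comm _ r] }
  have hDis : ∀ z : Fin (n + 1) → ℝ, Monotone z →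
      disagreement B z = ∑ i, ∑ j, B i j * (z (max i j) - z (min i j)) := by
    intro z hz
    refine sum_congr rfl fun i _ => sum_congr rfl fun j _ => ?_
    rcases le_total i j with h | h
    · rw [max_eq_right h, min_eq_left h, abs_sub_comm, abs_of_nonneg (sub_nonneg.2 (hz h))]
    · rw [max_eq_left h, min_eq_right h, abs_of_nonneg (sub_nonneg.2 (hz h))]
  have key : 0 ≤ F y := by
    refine linearMap_nonneg_of_monotone F ?_ ?_ hy
    · change ∑ i, ρ ^ (π i : ℕ) * ∑ j, B i j * 1 - ∑ i : Fin (n + 1), ρ ^ (i : ℕ) * 1 -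
        c * ∑ i, ∑ j, B i j * (1 - 1) = 0
      have := Equiv.sum_comp π fun i : Fin (n + 1) => ρ ^ (i : ℕ)
      simp [hrow, this]
    · intro k
      set S : Finset (Fin (n + 1)) := univ.filter fun i => k.castSucc < i with hS
      set z : Fin (n + 1) → ℝ := fun i => if k.castSucc < i then 1 else 0 with hz
      have hzS : ∀ i, z i = if i ∈ S then 1 else 0 := fun i => by simp [hz, hS]
      have hzm : Monotone z := by
        intro i j hij
        simp only [hz]
        split_ifs with h1 h2
        · rfl
        · exact absurd (h1.trans_le hij) h2
        · exact zero_le_one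
        · rfl
      have hSne : S.Nonempty := ⟨k.succ, by simp [hS]⟩
      have hSuniv : S ≠ univ := fun h => by
        have : k.castSucc ∈ S := h ▸ mem_univ _
        simp [hS] at this
      have hkn : (k : ℕ) ≤ n := k.2.le
      have gain := indicator_weighted_gain (S := S) (a := ρ ^ (k : ℕ)) (c := c) (ρ := ρ)
        (w := fun i : Fin (n + 1) => ρ ^ (i : ℕ)) hB hrow hdiag hη0 hη1 hK (hbal S hSne hSuniv)
        (by positivity) hρK hρ0 (by simpa using hρN) (fun i => by positivity)
        (fun i hi => by
          rw [← pow_succ']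
          refine pow_le_pow_of_le_one hρ0 hρ1 ?_
          simpa [hS, Fin.lt_def] using hi)
        (fun i hi => pow_le_pow_of_le_one hρ0 hρ1 (by simpa [hS, Fin.le_def] using hi)) hc
        (by
          have : η * ρ ^ n ≤ η * ρ ^ (k : ℕ) :=
            mul_le_mul_of_nonneg_left (pow_le_pow_of_le_one hρ0 hρ1 hkn) hη0
          simpa using hca.trans this) π
      have hdz : disagreement B z = cutWeight B S + cutWeight B Sᶜ := by
        rw [disagreement, ← sum_add_sum_compl S]
        congr 1
        · refine sum_congr rfl fun i hi => ?_
          rw [← sum_add_sum_compl S, sum_eq_zero, zero_add]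
          · refine sum_congr rfl fun j hj => ?_
            simp [hzS, hi, mem_compl.1 hj]
          · intro j hj
            simp [hzS, hi, hj]
        · refine sum_congr rfl fun i hi => ?_
          rw [← sum_add_sum_compl S, compl_compl,
            sum_eq_zero (s := Sᶜ) (f := fun j => B i j * |z i - z j|), add_zero]
          · refine sum_congr rfl fun j hj => ?_
            simp [hzS, hj, mem_compl.1 hi]
          · intro j hj
            simp [hzS, mem_compl.1 hi, mem_compl.1 hj]
      change 0 ≤ ∑ i, ρ ^ (π i : ℕ) * ∑ j, B i j * z j -
        ∑ i : Fin (n + 1), ρ ^ (i : ℕ) * z i -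
        c * ∑ i, ∑ j, B i j * (z (max i j) - z (min i j))
      rw [← hDis z hzm, hdz]
      have e1 : ∀ f : Fin (n + 1) → ℝ, ∑ i, f i * z i = ∑ i ∈ S, f i := fun f => by
        simp [hzS]
      simp only [e1]
      linarith
  have hkey : 0 ≤ ∑ i, ρ ^ (π i : ℕ) * ∑ j, B i j * y j -
        ∑ i : Fin (n + 1), ρ ^ (i : ℕ) * y i -
        c * ∑ i, ∑ j, B i j * (y (max i j) - y (min i j)) := key
  rw [← hDis y hy] at hkey
  linarith

lemma cutWeight_submatrix {ι : Type*} [Fintype ι] [DecidableEq ι] (B : Matrix ι ι ℝ)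
    (σ : Equiv.Perm ι) (S : Finset ι) :
    cutWeight (B.submatrix σ σ) S = cutWeight B (S.map σ.toEmbedding) := by
  have h : (S.map σ.toEmbedding)ᶜ = Sᶜ.map σ.toEmbedding := by
    ext i
    simp [mem_map_equiv]
  simp [cutWeight, h]

/-- The sorted weighted sum with rapidly decaying weights is a Lyapunov function for every
cut-balanced stochastic matrix, and its increase controls the disagreement. -/
lemma sortedSum_gain {n : ℕ} {B : Matrix (Fin (n + 1)) (Fin (n + 1)) ℝ}
    {η K ρ c : ℝ} (hB : ∀ i j, 0 ≤ B i j)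
    (hrow : ∀ i, ∑ j, B i j = 1) (hdiag : ∀ i, η ≤ B i i) (hη0 : 0 ≤ η) (hη1 : η ≤ 1)
    (hK : 0 ≤ K) (hbal : ∀ S, S.Nonempty → S ≠ univ → cutWeight B S ≤ K * cutWeight B Sᶜ)
    (hρ0 : 0 ≤ ρ) (hρ1 : ρ ≤ 1) (hρK : ρ * K ≤ 1 / 2)
    (hρN : ρ * (n + 1 : ℕ) ≤ η / 2)
    (hc : 0 ≤ c) (hca : 2 * c * ((n + 1 : ℕ) + K + 1) ≤ η * ρ ^ n)
    (x : Fin (n + 1) → ℝ) :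
    sortedSum (fun i : Fin (n + 1) => ρ ^ (i : ℕ)) x + c * disagreement B x ≤
      sortedSum (fun i : Fin (n + 1) => ρ ^ (i : ℕ)) (fun i => ∑ j, B i j * x j) := by
  refine le_inf' _ _ fun π _ => ?_
  set σ : Equiv.Perm (Fin (n + 1)) := Tuple.sort x
  have hsort : Monotone (x ∘ σ) := Tuple.monotone_sort x
  have hmain := sorted_weighted_gain (B := B.submatrix σ σ) (fun i j => hB _ _)
    (fun i => by
      rw [← hrow (σ i)]
      exact Equiv.sum_comp σ fun j => B (σ i) j)
    (fun i => hdiag _) hη0 hη1 hK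
    (fun S hS hS' => by
      have h : (S.map σ.toEmbedding)ᶜ = Sᶜ.map σ.toEmbedding := by
        ext i
        simp [mem_map_equiv]
      rw [cutWeight_submatrix, cutWeight_submatrix, ← h]
      refine hbal _ (hS.map) fun hh => hS' ?_
      rw [← card_eq_iff_eq_univ] at hh ⊢
      simpa using hh)
    hρ0 hρ1 hρK hρN hc hca (σ.trans π) hsort
  have h1 : sortedSum (fun i : Fin (n + 1) => ρ ^ (i : ℕ)) x ≤
      ∑ i : Fin (n + 1), ρ ^ (i : ℕ) * (x ∘ σ) i := by
    refine (inf'_le _ (mem_univ σ.symm)).trans (le_of_eq ?_)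
    rw [← Equiv.sum_comp σ]
    simp
  have h2 : disagreement (B.submatrix σ σ) (x ∘ σ) = disagreement B x := by
    simp only [disagreement, Matrix.submatrix_apply, Function.comp_apply]
    rw [← Equiv.sum_comp σ fun i => ∑ j, B i j * |x i - x j|]
    refine sum_congr rfl fun i _ => ?_
    exact Equiv.sum_comp σ fun j => B (σ i) j * |x (σ i) - x j|
  have h3 : ∑ i, ρ ^ ((σ.trans π) i : ℕ) * ∑ j, B.submatrix σ σ i j * (x ∘ σ) j =
      ∑ i, ρ ^ (π i : ℕ) * ∑ j, B i j * x j := by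
    rw [← Equiv.sum_comp σ fun i => ρ ^ (π i : ℕ) * ∑ j, B i j * x j]
    refine sum_congr rfl fun i _ => ?_
    congr 1
    exact Equiv.sum_comp σ fun j => B (σ i) j * x j
  rw [h2, h3] at hmain
  linarith

/-- Averaging by a stochastic matrix keeps all entries within distance `ε` of `c`. -/
lemma abs_average_sub_le {ι : Type*} [Fintype ι] {b x : ι → ℝ} {c ε : ℝ} (hb : ∀ j, 0 ≤ b j)
    (hsum : ∑ j, b j = 1) (hx : ∀ j, |x j - c| ≤ ε) : |∑ j, b j * x j - c| ≤ ε := by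
  have h : ∑ j, b j * x j - c = ∑ j, b j * (x j - c) := by
    simp [mul_sub, ← sum_mul, hsum]
  rw [h]
  calc |∑ j, b j * (x j - c)| ≤ ∑ j, |b j * (x j - c)| := abs_sum_le_sum_abs _ _
    _ ≤ ∑ j, b j * ε := sum_le_sum fun j _ => by
        rw [abs_mul, abs_of_nonneg (hb j)]
        exact mul_le_mul_of_nonneg_left (hx j) (hb j)
    _ = ε := by rw [← sum_mul, hsum, one_mul]

lemma disagreement_nonneg {ι : Type*} [Fintype ι] {B : Matrix ι ι ℝ}
    (hB : ∀ i j, 0 ≤ B i j) (x : ι → ℝ) : 0 ≤ disagreement B x :=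
  sum_nonneg fun _ _ => sum_nonneg fun _ _ => mul_nonneg (hB _ _) (abs_nonneg _)

lemma row_le_disagreement {ι : Type*} [Fintype ι] {B : Matrix ι ι ℝ}
    (hB : ∀ i j, 0 ≤ B i j) (x : ι → ℝ) (i : ι) :
    ∑ j, B i j * |x i - x j| ≤ disagreement B x :=
  single_le_sum (f := fun i => ∑ j, B i j * |x i - x j|)
    (fun _ _ => sum_nonneg fun _ _ => mul_nonneg (hB _ _) (abs_nonneg _)) (mem_univ i)

lemma summable_disagreement {n : ℕ} {B : ℕ → Matrix (Fin (n + 1)) (Fin (n + 1)) ℝ} {η K : ℝ}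
    (hη0 : 0 < η) (hη1 : η ≤ 1) (hK : 0 ≤ K) (hB : ∀ k i j, 0 ≤ B k i j)
    (hrow : ∀ k i, ∑ j, B k i j = 1) (hdiag : ∀ k i, η ≤ B k i i)
    (hbal : ∀ k S, S.Nonempty → S ≠ univ → cutWeight (B k) S ≤ K * cutWeight (B k) Sᶜ)
    {z : ℕ → Fin (n + 1) → ℝ} (hz : ∀ k i, z (k + 1) i = ∑ j, B k i j * z k j) :
    Summable fun k => disagreement (B k) (z k) := by
  set N : ℝ := ((n + 1 : ℕ) : ℝ) with hN
  have hN0 : 0 < N := by rw [hN]; positivity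
  set ρ : ℝ := η / (2 * (N + K)) with hρ
  have hρ0 : 0 < ρ := by positivity
  have hρe : ρ * N + ρ * K = η / 2 := by rw [hρ]; field_simp
  have hN1 : 1 ≤ N := by rw [hN]; exact_mod_cast Nat.succ_le_succ (Nat.zero_le n)
  have hρN0 : 0 ≤ ρ * N := by positivity
  have hρK0 : 0 ≤ ρ * K := by positivity
  have hρ1 : ρ ≤ 1 := by nlinarith
  set c : ℝ := η * ρ ^ n / (2 * (N + K + 1)) with hc
  have hc0 : 0 < c := by positivity
  have hca : 2 * c * (N + K + 1) = η * ρ ^ n := by rw [hc]; field_simp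
  set V : (Fin (n + 1) → ℝ) → ℝ := sortedSum fun i : Fin (n + 1) => ρ ^ (i : ℕ) with hV
  have hgain : ∀ k, V (z k) + c * disagreement (B k) (z k) ≤ V (z (k + 1)) := by
    intro k
    have h := sortedSum_gain (hB k) (hrow k) (hdiag k) hη0.le hη1 hK (hbal k) hρ0.le hρ1
      (by linarith) (by linarith) hc0.le hca.le (z k)
    rwa [← funext (hz k)] at h
  set M : ℝ := ∑ i, |z 0 i| with hM
  have hbound : ∀ k i, |z k i - 0| ≤ M := by
    intro k
    induction k with
    | zero =>
      intro i
      rw [sub_zero]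
      exact single_le_sum (f := fun i => |z 0 i|) (fun _ _ => abs_nonneg _) (mem_univ i)
    | succ k ih =>
      intro i
      rw [hz]
      exact abs_average_sub_le (hB k i) (hrow k i) ih
  have hVbound : ∀ k, V (z k) ≤ ∑ i : Fin (n + 1), ρ ^ (i : ℕ) * M := by
    intro k
    refine (inf'_le _ (mem_univ (Equiv.refl _))).trans (sum_le_sum fun i _ => ?_)
    have := (le_abs_self _).trans (hbound k i)
    rw [sub_zero] at this
    exact mul_le_mul_of_nonneg_left this (by positivity)
  have htel : ∀ m, V (z 0) + c * ∑ k ∈ range m, disagreement (B k) (z k) ≤ V (z m) := by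
    intro m
    induction m with
    | zero => simp
    | succ m ih => rw [sum_range_succ, mul_add]; linarith [hgain m]
  refine summable_of_sum_range_le (c := (∑ i : Fin (n + 1), ρ ^ (i : ℕ) * M - V (z 0)) / c)
    (fun k => disagreement_nonneg (hB k) _) fun m => ?_
  rw [le_div_iff₀' hc0]
  linarith [htel m, hVbound m]

/-- For a sequence of cut-balanced stochastic matrices every trajectory converges, and the limits
agree along arcs of infinite total weight. -/
lemma exists_limit_of_cutBalanced {n : ℕ} {B : ℕ → Matrix (Fin (n + 1)) (Fin (n + 1)) ℝ}
    {η K : ℝ}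
    (hη0 : 0 < η) (hη1 : η ≤ 1) (hK : 0 ≤ K) (hB : ∀ k i j, 0 ≤ B k i j)
    (hrow : ∀ k i, ∑ j, B k i j = 1) (hdiag : ∀ k i, η ≤ B k i i)
    (hbal : ∀ k S, S.Nonempty → S ≠ univ → cutWeight (B k) S ≤ K * cutWeight (B k) Sᶜ)
    {z : ℕ → Fin (n + 1) → ℝ} (hz : ∀ k i, z (k + 1) i = ∑ j, B k i j * z k j) :
    ∃ l : Fin (n + 1) → ℝ, (∀ i, Tendsto (fun k => z k i) atTop (nhds (l i))) ∧
      ∀ i j, (¬ Summable fun k => B k i j) → l j = l i := by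
  have hsum := summable_disagreement hη0 hη1 hK hB hrow hdiag hbal hz
  have hlim : ∀ i, ∃ l, Tendsto (fun k => z k i) atTop (nhds l) := by
    intro i
    refine cauchySeq_tendsto_of_complete (cauchySeq_of_dist_le_of_summable _ (fun k => ?_) hsum)
    have h : z k i - z (k + 1) i = ∑ j, B k i j * (z k i - z k j) := by
      simp [mul_sub, ← sum_mul, hrow, hz]
    rw [Real.dist_eq, h]
    refine (abs_sum_le_sum_abs _ _).trans ((le_of_eq ?_).trans
      (row_le_disagreement (hB k) (z k) i))
    exact sum_congr rfl fun j _ => by rw [abs_mul, abs_of_nonneg (hB k i j)]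
  choose l hl using hlim
  refine ⟨l, hl, fun i j hij => ?_⟩
  by_contra hne
  have hpos : 0 < |l i - l j| := abs_pos.2 (sub_ne_zero.2 (Ne.symm hne))
  have hev : ∀ᶠ k in atTop, |l i - l j| / 2 < |z k i - z k j| :=
    ((hl i).sub (hl j)).abs.eventually (lt_mem_nhds (half_lt_self hpos))
  refine hij (Summable.of_norm_bounded_eventually_nat (hsum.mul_left (2 / |l i - l j|)) ?_)
  filter_upwards [hev] with k hk
  rw [Real.norm_of_nonneg (hB k i j), div_mul_eq_mul_div, le_div_iff₀ hpos]
  have h1 : B k i j * |z k i - z k j| ≤ disagreement (B k) (z k) :=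
    (single_le_sum (f := fun j => B k i j * |z k i - z k j|)
      (fun _ _ => mul_nonneg (hB _ _ _) (abs_nonneg _)) (mem_univ j)).trans
      (row_le_disagreement (hB k) (z k) i)
  nlinarith [hB k i j]

/-- The transition matrix of the system from time `s` to time `s + n`. -/
def transition {ι : Type*} [Fintype ι] [DecidableEq ι] (A : ℕ → Matrix ι ι ℝ) (s : ℕ) :
    ℕ → Matrix ι ι ℝ
  | 0 => 1
  | n + 1 => A (s + n) * transition A s n

section Transition

variable {ι : Type*} [Fintype ι] [DecidableEq ι] {A : ℕ → Matrix ι ι ℝ} {η : ℝ}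

lemma transition_succ_apply (s n : ℕ) (i j : ι) :
    transition A s (n + 1) i j = ∑ k, A (s + n) i k * transition A s n k j := by
  rw [transition, Matrix.mul_apply]

lemma transition_nonneg (hA : ∀ t i j, 0 ≤ A t i j) (s n : ℕ) (i j : ι) :
    0 ≤ transition A s n i j := by
  induction n generalizing i with
  | zero => rw [transition, Matrix.one_apply]; split_ifs <;> simp
  | succ n ih =>
    rw [transition_succ_apply]
    exact sum_nonneg fun k _ => mul_nonneg (hA _ _ _) (ih k)

lemma transition_row_sum (hrow : ∀ t i, ∑ j, A t i j = 1) (s n : ℕ) (i : ι) :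
    ∑ j, transition A s n i j = 1 := by
  induction n generalizing i with
  | zero => simp [transition, Matrix.one_apply]
  | succ n ih =>
    simp only [transition_succ_apply]
    rw [sum_comm]
    simp [← mul_sum, ih, hrow]

lemma mul_transition_le (hA : ∀ t i j, 0 ≤ A t i j) (s n : ℕ) (i k j : ι) :
    A (s + n) i k * transition A s n k j ≤ transition A s (n + 1) i j := by
  rw [transition_succ_apply]
  exact single_le_sum (f := fun k => A (s + n) i k * transition A s n k j)
    (fun _ _ => mul_nonneg (hA _ _ _) (transition_nonneg hA _ _ _ _)) (mem_univ k)

lemma pow_le_transition_diag (hA : ∀ t i j, 0 ≤ A t i j) (hη0 : 0 ≤ η)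
    (hdiag : ∀ t i, η ≤ A t i i) (s n : ℕ) (i : ι) : η ^ n ≤ transition A s n i i := by
  induction n with
  | zero => simp [transition]
  | succ n ih =>
    rw [pow_succ']
    exact (mul_le_mul (hdiag _ _) ih (by positivity) (hA _ _ _)).trans
      (mul_transition_le hA s n i i i)

lemma pow_mul_le_transition (hA : ∀ t i j, 0 ≤ A t i j) (hη0 : 0 ≤ η) (hη1 : η ≤ 1)
    (hdiag : ∀ t i, η ≤ A t i i) (s : ℕ) {m n : ℕ} (hmn : m < n) (i j : ι) :
    η ^ n * A (s + m) i j ≤ transition A s n i j := by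
  induction n with
  | zero => omega
  | succ n ih =>
    rcases Nat.lt_succ_iff_lt_or_eq.1 hmn with h | rfl
    · refine le_trans ?_ (mul_transition_le hA s n i i j)
      rw [pow_succ', mul_assoc]
      exact mul_le_mul (hdiag _ _) (ih h) (mul_nonneg (by positivity) (hA _ _ _)) (hA _ _ _)
    · refine le_trans ?_ (mul_transition_le hA s m i j j)
      rw [mul_comm]
      refine mul_le_mul_of_nonneg_left ?_ (hA _ _ _)
      exact (pow_le_pow_of_le_one hη0 hη1 m.le_succ).trans
        (pow_le_transition_diag hA hη0 hdiag s m j)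

lemma transition_row_cut_le (hA : ∀ t i j, 0 ≤ A t i j) (hrow : ∀ t i, ∑ j, A t i j = 1)
    (s n : ℕ) (S : Finset ι) {i : ι} (hi : i ∈ S) :
    ∑ j ∈ Sᶜ, transition A s n i j ≤ ∑ m ∈ range n, cutWeight (A (s + m)) S := by
  induction n generalizing i with
  | zero =>
    refine le_of_eq (sum_eq_zero fun j hj => ?_)
    rw [transition, Matrix.one_apply_ne]
    rintro rfl
    exact mem_compl.1 hj hi
  | succ n ih =>
    have hC : 0 ≤ ∑ m ∈ range n, cutWeight (A (s + m)) S :=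
      sum_nonneg fun m _ => cutWeight_nonneg (hA _) S
    simp only [transition_succ_apply]
    rw [sum_comm, sum_range_succ, ← sum_add_sum_compl S]
    simp only [← mul_sum]
    refine add_le_add ?_ (le_trans ?_ (row_le_cutWeight (hA _) hi))
    · calc ∑ k ∈ S, A (s + n) i k * ∑ j ∈ Sᶜ, transition A s n k j
          ≤ ∑ k ∈ S, A (s + n) i k * ∑ m ∈ range n, cutWeight (A (s + m)) S :=
            sum_le_sum fun k hk => mul_le_mul_of_nonneg_left (ih hk) (hA _ _ _)
        _ = (∑ k ∈ S, A (s + n) i k) * ∑ m ∈ range n, cutWeight (A (s + m)) S := by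
            rw [sum_mul]
        _ ≤ 1 * ∑ m ∈ range n, cutWeight (A (s + m)) S := by
            refine mul_le_mul_of_nonneg_right ?_ hC
            rw [← hrow (s + n) i]
            exact sum_le_sum_of_subset_of_nonneg (subset_univ _) fun _ _ _ => hA _ _ _
        _ = _ := one_mul _
    · refine sum_le_sum fun k _ => mul_le_of_le_one_right (hA _ _ _) ?_
      rw [← transition_row_sum hrow s n k]
      exact sum_le_sum_of_subset_of_nonneg (subset_univ _) fun _ _ _ =>
        transition_nonneg hA _ _ _ _

lemma cutWeight_transition_le (hA : ∀ t i j, 0 ≤ A t i j) (hrow : ∀ t i, ∑ j, A t i j = 1)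
    (s n : ℕ) (S : Finset ι) :
    cutWeight (transition A s n) S ≤
      Fintype.card ι * ∑ m ∈ range n, cutWeight (A (s + m)) S := by
  have h := sum_le_sum fun i (hi : i ∈ S) => transition_row_cut_le hA hrow s n S hi
  rw [sum_const, nsmul_eq_mul] at h
  refine h.trans (mul_le_mul_of_nonneg_right ?_
    (sum_nonneg fun m _ => cutWeight_nonneg (hA _) S))
  exact_mod_cast card_le_univ S

lemma pow_mul_cutWeight_le (hA : ∀ t i j, 0 ≤ A t i j) (hη0 : 0 ≤ η) (hη1 : η ≤ 1)
    (hdiag : ∀ t i, η ≤ A t i i) (s n : ℕ) (S : Finset ι) :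
    η ^ n * ∑ m ∈ range n, cutWeight (A (s + m)) S ≤ n * cutWeight (transition A s n) S := by
  have h : ∀ m ∈ range n, η ^ n * cutWeight (A (s + m)) S ≤ cutWeight (transition A s n) S := by
    intro m hm
    simp only [cutWeight, mul_sum]
    exact sum_le_sum fun i _ => sum_le_sum fun j _ =>
      pow_mul_le_transition hA hη0 hη1 hdiag s (mem_range.1 hm) i j
  rw [mul_sum]
  simpa using sum_le_sum h

/-- Balance over windows of length `n` makes the transition matrices cut-balanced. -/
lemma cutWeight_transition_balanced (hA : ∀ t i j, 0 ≤ A t i j)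
    (hrow : ∀ t i, ∑ j, A t i j = 1) (hη0 : 0 < η) (hη1 : η ≤ 1)
    (hdiag : ∀ t i, η ≤ A t i i) {K : ℝ} (hK : 0 ≤ K) (s n : ℕ) (S : Finset ι)
    (hbal : ∑ m ∈ range n, cutWeight (A (s + m)) S ≤
      K * ∑ m ∈ range n, cutWeight (A (s + m)) Sᶜ) :
    cutWeight (transition A s n) S ≤
      (Fintype.card ι * K * n / η ^ n) * cutWeight (transition A s n) Sᶜ := by
  have h1 := cutWeight_transition_le hA hrow s n S
  have h2 := pow_mul_cutWeight_le hA hη0.le hη1 hdiag s n Sᶜ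
  have hpow : 0 < η ^ n := by positivity
  rw [← le_div_iff₀' hpow] at h2
  calc _ ≤ _ := h1
    _ ≤ Fintype.card ι * (K * (n * cutWeight (transition A s n) Sᶜ / η ^ n)) := by
        gcongr
        exact hbal.trans (by gcongr)
    _ = _ := by ring

lemma eq_transition_mulVec {t0 s : ℕ} (hs : t0 ≤ s) {x : ℕ → ι → ℝ}
    (hx : ∀ t, t0 ≤ t → ∀ i, x (t + 1) i = ∑ j, A t i j * x t j) (n : ℕ) (i : ι) :
    x (s + n) i = ∑ j, transition A s n i j * x s j := by
  induction n generalizing i with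
  | zero => simp [transition, Matrix.one_apply]
  | succ n ih =>
    rw [← add_assoc, hx _ (by omega)]
    simp only [ih, transition_succ_apply, mul_sum, sum_mul]
    rw [sum_comm]
    simp only [mul_assoc]

lemma not_summable_transition (hA : ∀ t i j, 0 ≤ A t i j) (hη0 : 0 < η) (hη1 : η ≤ 1)
    (hdiag : ∀ t i, η ≤ A t i i) {L : ℕ} (hL : 1 ≤ L) (t0 : ℕ) {i j : ι}
    (h : ¬ Summable fun t => A t i j) :
    ¬ Summable fun k => transition A (t0 + k * L) L i j := by
  intro hsum
  apply h
  have hpow : 0 < η ^ L := by positivity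
  have hle : ∀ n, η ^ L * ∑ t ∈ range (t0 + n * L), A t i j ≤
      η ^ L * ∑ t ∈ range t0, A t i j +
        L * ∑ k ∈ range n, transition A (t0 + k * L) L i j := by
    intro n
    induction n with
    | zero => simp
    | succ n ih =>
      have hwin : η ^ L * ∑ m ∈ range L, A (t0 + n * L + m) i j ≤
          L * transition A (t0 + n * L) L i j := by
        rw [mul_sum]
        simpa using sum_le_sum fun m hm =>
          pow_mul_le_transition hA hη0.le hη1 hdiag (t0 + n * L) (mem_range.1 hm) i j
      rw [show t0 + (n + 1) * L = t0 + n * L + L by ring, sum_range_add, sum_range_succ]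
      linarith
  refine summable_of_sum_range_le (c := (η ^ L * ∑ t ∈ range t0, A t i j +
    L * ∑' k, transition A (t0 + k * L) L i j) / η ^ L) (fun t => hA t i j) fun n => ?_
  rw [le_div_iff₀' hpow]
  have hn : n ≤ t0 + n * L := (Nat.le_mul_of_pos_right n hL).trans (Nat.le_add_left _ _)
  calc η ^ L * ∑ t ∈ range n, A t i j ≤ η ^ L * ∑ t ∈ range (t0 + n * L), A t i j := by
        exact mul_le_mul_of_nonneg_left (sum_le_sum_of_subset_of_nonneg (range_mono hn)
          fun _ _ _ => hA _ _ _) hpow.le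
    _ ≤ _ := hle n
    _ ≤ _ := by
        gcongr
        exact hsum.sum_le_tsum _ fun k _ => transition_nonneg hA _ _ _ _

end Transition

lemma persistentArc_iff_not_summable {N : ℕ} {A : ℕ → Matrix (Fin N) (Fin N) ℝ}
    (hA : ∀ t i j, 0 ≤ A t i j) (j i : Fin N) :
    PersistentArc A j i ↔ ¬ Summable fun t => A t i j :=
  (not_summable_iff_tendsto_nat_atTop_of_nonneg fun t => hA t i j).symm

/-- If the total weight across the cut `(S, Sᶜ)` in both directions is finite, some trajectory
does not reach consensus. -/
lemma not_consensus_of_summable_cut {N : ℕ} {A : ℕ → Matrix (Fin N) (Fin N) ℝ}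
    (hA : ∀ t i j, 0 ≤ A t i j) (hrow : ∀ t i, ∑ j, A t i j = 1) {S : Finset (Fin N)}
    {r i₀ : Fin N} (hr : r ∈ S) (hi₀ : i₀ ∉ S) (hsum : Summable fun t => cutWeight (A t) S)
    (hsum' : Summable fun t => cutWeight (A t) Sᶜ) :
    ¬ ∀ t0 : ℕ, ∀ x : ℕ → Fin N → ℝ,
        (∀ t, t0 ≤ t → ∀ i, x (t + 1) i = ∑ j, A t i j * x t j) →
        ∃ c : ℝ, ∀ i, Tendsto (fun t => x t i) atTop (nhds c) := by
  intro hcons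
  set f : ℕ → ℝ := fun t => cutWeight (A t) S + cutWeight (A t) Sᶜ with hf
  have hf0 : ∀ t, 0 ≤ f t := fun t =>
    add_nonneg (cutWeight_nonneg (hA t) _) (cutWeight_nonneg (hA t) _)
  have hfs : Summable f := hsum.add hsum'
  obtain ⟨t0, ht0⟩ : ∃ t0, ∑' k, f (k + t0) < 1 / 4 :=
    ((tendsto_sum_nat_add f).eventually (gt_mem_nhds (by norm_num))).exists
  set x0 : Fin N → ℝ := fun i => if i ∈ S then 1 else 0 with hx0
  set x : ℕ → Fin N → ℝ := fun t i => ∑ j, transition A t0 (t - t0) i j * x0 j with hx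
  have hstep : ∀ t, t0 ≤ t → ∀ i, x (t + 1) i = ∑ j, A t i j * x t j := by
    intro t ht i
    obtain ⟨n, rfl⟩ := Nat.exists_eq_add_of_le ht
    simp only [hx, show t0 + n + 1 - t0 = n + 1 by omega, show t0 + n - t0 = n by omega,
      transition_succ_apply, mul_sum, sum_mul]
    rw [sum_comm]
    simp only [mul_assoc]
  obtain ⟨c, hc⟩ := hcons t0 x hstep
  have hinv : ∀ n, (∀ i, 0 ≤ x (t0 + n) i ∧ x (t0 + n) i ≤ 1) ∧
      (∀ i ∈ S, 1 - ∑ k ∈ range n, f (k + t0) ≤ x (t0 + n) i) ∧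
      ∀ i ∉ S, x (t0 + n) i ≤ ∑ k ∈ range n, f (k + t0) := by
    intro n
    induction n with
    | zero =>
      have h0 : ∀ i, x t0 i = x0 i := fun i => by simp [hx, transition, Matrix.one_apply]
      refine ⟨fun i => ?_, fun i hi => ?_, fun i hi => ?_⟩
      · rw [add_zero, h0]
        simp only [hx0]
        split_ifs <;> simp
      · simp [h0, hx0, hi]
      · simp [h0, hx0, hi]
    | succ n ih =>
      obtain ⟨ih1, ih2, ih3⟩ := ih
      have hu : 0 ≤ ∑ k ∈ range n, f (k + t0) := sum_nonneg fun _ _ => hf0 _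
      have hs := hstep (t0 + n) (by omega)
      rw [sum_range_succ, add_comm n t0, ← add_assoc t0 n 1]
      set u := ∑ k ∈ range n, f (k + t0)
      set t := t0 + n
      have hcut := cutWeight_nonneg (hA t) S
      have hcut' := cutWeight_nonneg (hA t) Sᶜ
      refine ⟨fun i => ⟨?_, ?_⟩, fun i hi => ?_, fun i hi => ?_⟩
      · rw [hs]
        exact sum_nonneg fun j _ => mul_nonneg (hA _ _ _) (ih1 j).1
      · rw [hs, ← hrow t i]
        exact sum_le_sum fun j _ => mul_le_of_le_one_right (hA _ _ _) (ih1 j).2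
      · rw [hs, ← sum_add_sum_compl S]
        have h1 : ∑ j ∈ S, A t i j * (1 - u) ≤ ∑ j ∈ S, A t i j * x t j :=
          sum_le_sum fun j hj => mul_le_mul_of_nonneg_left (ih2 j hj) (hA _ _ _)
        have h2 : 0 ≤ ∑ j ∈ Sᶜ, A t i j * x t j :=
          sum_nonneg fun j _ => mul_nonneg (hA _ _ _) (ih1 j).1
        have h3 := row_le_cutWeight (hA t) hi
        have h4 : ∑ j ∈ S, A t i j + ∑ j ∈ Sᶜ, A t i j = 1 := by
          rw [sum_add_sum_compl, hrow]
        have h5 : 0 ≤ ∑ j ∈ Sᶜ, A t i j := sum_nonneg fun j _ => hA _ _ _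
        rw [← sum_mul] at h1
        simp only [hf]
        nlinarith
      · rw [hs, ← sum_add_sum_compl S]
        have h1 : ∑ j ∈ S, A t i j * x t j ≤ ∑ j ∈ S, A t i j :=
          sum_le_sum fun j hj => mul_le_of_le_one_right (hA _ _ _) (ih1 j).2
        have h2 : ∑ j ∈ Sᶜ, A t i j * x t j ≤ ∑ j ∈ Sᶜ, A t i j * u :=
          sum_le_sum fun j hj => mul_le_mul_of_nonneg_left (ih3 j (mem_compl.1 hj)) (hA _ _ _)
        have h3 := row_le_cutWeight (hA t) (mem_compl.2 hi)
        rw [compl_compl] at h3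
        have h4 : ∑ j ∈ S, A t i j + ∑ j ∈ Sᶜ, A t i j = 1 := by
          rw [sum_add_sum_compl, hrow]
        have h5 : 0 ≤ ∑ j ∈ S, A t i j := sum_nonneg fun j _ => hA _ _ _
        rw [← sum_mul] at h2
        simp only [hf]
        nlinarith
  have hpart : ∀ n, ∑ k ∈ range n, f (k + t0) ≤ 1 / 4 := fun n =>
    (((summable_nat_add_iff t0).2 hfs).sum_le_tsum _ fun k _ => hf0 _).trans ht0.le
  have hc1 : 3 / 4 ≤ c := by
    refine ge_of_tendsto (hc r) ?_
    filter_upwards [eventually_ge_atTop t0] with t ht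
    obtain ⟨n, rfl⟩ := Nat.exists_eq_add_of_le ht
    linarith [(hinv n).2.1 r hr, hpart n]
  have hc2 : c ≤ 1 / 4 := by
    refine le_of_tendsto (hc i₀) ?_
    filter_upwards [eventually_ge_atTop t0] with t ht
    obtain ⟨n, rfl⟩ := Nat.exists_eq_add_of_le ht
    linarith [(hinv n).2.2 i₀ hi₀, hpart n]
  linarith

theorem stmt2 (N : ℕ) (hN : 2 ≤ N) (A : ℕ → Matrix (Fin N) (Fin N) ℝ)
    (η : ℝ) (hη0 : 0 < η) (hη1 : η < 1)
    (hnonneg : ∀ t i j, 0 ≤ A t i j)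
    (hrow : ∀ t i, ∑ j, A t i j = 1)
    (hdiag : ∀ t i, η ≤ A t i i)
    (L : ℕ) (hL : 1 ≤ L) (K : ℝ) (hK : 1 ≤ K)
    (hbal : ∀ S : Finset (Fin N), S.Nonempty → S ≠ Finset.univ → ∀ s : ℕ,
      ∑ t ∈ Finset.Ico s (s + L), ∑ i ∈ Sᶜ, ∑ j ∈ S, A t i j ≤
        K * ∑ t ∈ Finset.Ico s (s + L), ∑ i ∈ S, ∑ j ∈ Sᶜ, A t i j) :
    (∀ t0 : ℕ, ∀ x : ℕ → Fin N → ℝ,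
        (∀ t, t0 ≤ t → ∀ i, x (t + 1) i = ∑ j, A t i j * x t j) →
        ∃ c : ℝ, ∀ i, Tendsto (fun t => x t i) atTop (nhds c)) ↔
      HasDirectedSpanningTree (PersistentArc A) := by
  have hbal' : ∀ (S : Finset (Fin N)), S.Nonempty → S ≠ univ → ∀ s,
      ∑ m ∈ range L, cutWeight (A (s + m)) S ≤ K * ∑ m ∈ range L, cutWeight (A (s + m)) Sᶜ := by
    intro S hS hS' s
    have h := hbal Sᶜ (by rwa [nonempty_iff_ne_empty, Ne, compl_eq_empty_iff])
      (by rw [Ne, compl_eq_univ_iff]; exact hS.ne_empty) s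
    rw [sum_Ico_eq_sum_range, sum_Ico_eq_sum_range, compl_compl, Nat.add_sub_cancel_left] at h
    simpa only [cutWeight, compl_compl] using h
  constructor
  · intro hcons
    by_contra htree
    let r : Fin N := ⟨0, by omega⟩
    obtain ⟨i₀, hi₀⟩ : ∃ i, ¬ Relation.ReflTransGen (PersistentArc A) r i := by
      by_contra! h
      exact htree ⟨r, h⟩
    classical
    set S : Finset (Fin N) := univ.filter fun i => Relation.ReflTransGen (PersistentArc A) r i
      with hS
    have hrS : r ∈ S := by simp [hS, Relation.ReflTransGen.refl]
    have hi₀S : i₀ ∉ S := by simpa [hS] using hi₀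
    have hout : Summable fun t => cutWeight (A t) Sᶜ := by
      refine summable_sum fun i hi => summable_sum fun j hj => ?_
      by_contra hns
      rw [compl_compl] at hj
      have hj' : Relation.ReflTransGen (PersistentArc A) r j := by simpa [hS] using hj
      have hi' : ¬ Relation.ReflTransGen (PersistentArc A) r i := by simpa [hS] using hi
      exact hi' (hj'.tail ((persistentArc_iff_not_summable hnonneg j i).2 hns))
    have hin : Summable fun t => cutWeight (A t) S := by
      have hwin : Summable fun s => K * ∑ m ∈ range L, cutWeight (A (s + m)) Sᶜ :=
        (summable_sum fun m _ => (summable_nat_add_iff m).2 hout).mul_left K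
      refine Summable.of_nonneg_of_le (fun t => cutWeight_nonneg (hnonneg t) S) (fun t => ?_) hwin
      refine le_trans ?_ (hbal' S ⟨r, hrS⟩ (fun h => hi₀S (h ▸ mem_univ _)) t)
      exact single_le_sum (f := fun m => cutWeight (A (t + m)) S)
        (fun m _ => cutWeight_nonneg (hnonneg _) S) (mem_range.2 hL)
    exact not_consensus_of_summable_cut hnonneg hrow hrS hi₀S hin hout hcons
  · rintro ⟨r, hr⟩ t0 x hx
    obtain ⟨n, rfl⟩ : ∃ n, N = n + 1 := ⟨N - 1, by omega⟩
    have hK0 : 0 ≤ K := by linarith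
    obtain ⟨l, hl, hlarc⟩ := exists_limit_of_cutBalanced
      (B := fun k => transition A (t0 + k * L) L) (z := fun k => x (t0 + k * L))
      (pow_pos hη0 L) (pow_le_one₀ hη0.le hη1.le)
      (K := (Fintype.card (Fin (n + 1)) : ℝ) * K * L / η ^ L) (by positivity)
      (fun k => transition_nonneg hnonneg _ _) (fun k => transition_row_sum hrow _ _)
      (fun k => pow_le_transition_diag hnonneg hη0.le hdiag _ _)
      (fun k S hS hS' => cutWeight_transition_balanced hnonneg hrow hη0 hη1.le hdiag hK0 _ _ S
        (hbal' S hS hS' _))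
      (fun k i => by
        rw [← eq_transition_mulVec (by omega) hx, add_mul, one_mul, add_assoc])
    have hlr : ∀ i, l i = l r := fun i => by
      induction hr i with
      | refl => rfl
      | tail _ harc ih =>
        rw [← ih]
        exact (hlarc _ _ (not_summable_transition hnonneg hη0 hη1.le hdiag hL t0
          ((persistentArc_iff_not_summable hnonneg _ _).1 harc))).symm
    refine ⟨l r, fun i => Metric.tendsto_atTop'.2 fun ε hε => ?_⟩
    have hev : ∀ᶠ k in atTop, ∀ j, |x (t0 + k * L) j - l r| < ε / 2 := by
      refine eventually_all.2 fun j => ?_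
      have h := (hl j).eventually (Metric.ball_mem_nhds _ (half_pos hε))
      rw [hlr j] at h
      exact h
    obtain ⟨k, hk⟩ := hev.exists
    refine ⟨t0 + k * L, fun t ht => ?_⟩
    obtain ⟨m, rfl⟩ := Nat.exists_eq_add_of_le ht.le
    rw [Real.dist_eq, eq_transition_mulVec (Nat.le_add_right _ _) hx]
    exact (abs_average_sub_le (transition_nonneg hnonneg _ _ i) (transition_row_sum hrow _ _ i)
      fun j => (hk j).le).trans_lt (half_lt_self hε)
end

section
/- Consider the system y(t+1) = B(t) y(t), where each B(t) is an N×N row-stochastic matrix satisfying the balanced asymmetry condition with a common constant M ≥ 1. Let P = ⌊N/2⌋ and suppose s = τ_0 < τ_1 < ⋯ < τ_P = t are integers such that for each q ∈ {0,…,P−1} and every sequence S(τ_q), S(τ_q + 1), …, S(τ_{q+1}) of nonempty proper subsets of {1,…,N} all having the same cardinality, ∑_{k=τ_q}^{τ_{q+1}−1} ∑_{i∉S(k+1), j∈S(k)} b_ij(k) ≥ 1. Then Φ(t) ≤ (1 − M^{−⌊N/2⌋}/(8N²)^{⌊N/2⌋}) Φ(s), where Φ(t) = max_i y_i(t) − min_i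 y_i(t). -/
open Filter Finset

/-- The indices of `Fin N` whose value is below `l`. -/
def lowerIndices (N l : ℕ) : Finset (Fin N) := univ.filter fun i => (i : ℕ) < l

lemma mem_lowerIndices {N l : ℕ} {i : Fin N} : i ∈ lowerIndices N l ↔ (i : ℕ) < l := by
  simp [lowerIndices]

lemma mem_compl_lowerIndices {N l : ℕ} {i : Fin N} : i ∈ (lowerIndices N l)ᶜ ↔ l ≤ (i : ℕ) := by
  simp [lowerIndices]

lemma card_lowerIndices {N l : ℕ} (hl : l ≤ N) : (lowerIndices N l).card = l := by
  rw [lowerIndices, Fin.card_filter_val_lt]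
  exact min_eq_right hl

/-- The total weight of the entries of `A` whose row is at least `l` and whose column is below
`l`. -/
def cutDown {N : ℕ} (A : Matrix (Fin N) (Fin N) ℝ) (l : ℕ) : ℝ :=
  ∑ i ∈ (lowerIndices N l)ᶜ, ∑ j ∈ lowerIndices N l, A i j

/-- The total weight of the entries of `A` whose row is below `l` and whose column is at least
`l`. -/
def cutUp {N : ℕ} (A : Matrix (Fin N) (Fin N) ℝ) (l : ℕ) : ℝ :=
  ∑ i ∈ lowerIndices N l, ∑ j ∈ (lowerIndices N l)ᶜ, A i j

lemma cutDown_nonneg {N : ℕ} {A : Matrix (Fin N) (Fin N) ℝ} (hA : ∀ i j, 0 ≤ A i j) (l : ℕ) :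
    0 ≤ cutDown A l :=
  sum_nonneg fun _ _ => sum_nonneg fun _ _ => hA _ _

lemma cutUp_nonneg {N : ℕ} {A : Matrix (Fin N) (Fin N) ℝ} (hA : ∀ i j, 0 ≤ A i j) (l : ℕ) :
    0 ≤ cutUp A l :=
  sum_nonneg fun _ _ => sum_nonneg fun _ _ => hA _ _

/-- Pairing with the indicator of an upper set sums over that set. -/
lemma sum_mul_upper_indicator {N : ℕ} (f : Fin N → ℝ) (l : ℕ) :
    (∑ j, f j * if l ≤ (j : ℕ) then 1 else 0) = ∑ j ∈ (lowerIndices N l)ᶜ, f j := by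
  simp only [mul_ite, mul_one, mul_zero]
  rw [← sum_filter]
  congr 1
  ext j
  simp [mem_lowerIndices]

/-- A monotone vector is a constant plus a nonnegative combination of indicators of upper sets. -/
lemma exists_increments {N : ℕ} (z : Fin N → ℝ) (hz : Monotone z) :
    ∃ (c : ℝ) (d : ℕ → ℝ), d 0 = 0 ∧ (∀ m, 0 ≤ d m) ∧
      (∀ j, z j = c + ∑ m ∈ range N, d m * if m ≤ (j : ℕ) then 1 else 0) ∧
      ∀ m (hm : m + 1 < N), d (m + 1) = z ⟨m + 1, hm⟩ - z ⟨m, by omega⟩ := by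
  rcases Nat.eq_zero_or_pos N with rfl | hN
  · exact ⟨0, 0, rfl, fun _ => le_rfl, fun j => j.elim0, fun m hm => by omega⟩
  set Z : ℕ → ℝ := fun n => z ⟨min n (N - 1), by omega⟩ with hZ
  have hZfin : ∀ n (hn : n < N), Z n = z ⟨n, hn⟩ := fun n hn => by
    simp only [hZ]; congr 2; omega
  have hZmono : Monotone Z := fun a b hab => hz (by simp only [Fin.mk_le_mk]; omega)
  refine ⟨Z 0, fun m => Z m - Z (m - 1), by simp, fun m => ?_, fun j => ?_, fun m hm => ?_⟩
  · exact sub_nonneg.2 (hZmono (Nat.sub_le _ _))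
  · have htel : ∀ n, ∑ m ∈ range (n + 1), (Z m - Z (m - 1)) = Z n - Z 0 := fun n => by
      rw [sum_range_succ', ← sum_range_sub Z n]
      simp
    have hsub : (range N).filter (fun m => m ≤ (j : ℕ)) = range (j + 1) := by
      ext m
      simp only [mem_filter, mem_range]
      omega
    simp only [mul_ite, mul_one, mul_zero]
    rw [← sum_filter, hsub, htel, hZfin j j.2]
    ring
  · simp only [Nat.add_sub_cancel]
    rw [hZfin _ hm, hZfin]

/-- The drift of a weighted sum of the lower coordinates along an indicator of an upper set. -/
lemma indicator_drift_nonneg {N : ℕ} {A : Matrix (Fin N) (Fin N) ℝ} (hA : ∀ i j, 0 ≤ A i j)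
    (hrow : ∀ i, ∑ j, A i j = 1) {M : ℝ} {w : ℕ → ℝ} (hw : ∀ i, 0 ≤ w i) (hanti : Antitone w)
    {l m : ℕ} (hwM : M * w (m + 1) ≤ w m) (hm : m + 1 < l)
    (hcut : cutDown A (m + 1) ≤ M * cutUp A (m + 1)) :
    0 ≤ ∑ i ∈ lowerIndices N l, w i *
      ((∑ j, A i j * if m + 1 ≤ (j : ℕ) then 1 else 0) - if m + 1 ≤ (i : ℕ) then 1 else 0) := by
  have hin : ∀ i, (∑ j, A i j * if m + 1 ≤ (j : ℕ) then 1 else 0) =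
      ∑ j ∈ (lowerIndices N (m + 1))ᶜ, A i j := fun i => sum_mul_upper_indicator _ _
  have hout : ∀ i, ∑ j ∈ (lowerIndices N (m + 1))ᶜ, A i j - 1 =
      -∑ j ∈ lowerIndices N (m + 1), A i j := fun i => by
    rw [← hrow i, ← sum_add_sum_compl (lowerIndices N (m + 1))]
    ring
  have hsub : lowerIndices N (m + 1) ⊆ lowerIndices N l := fun i hi => by
    rw [mem_lowerIndices] at *; omega
  rw [← sum_sdiff hsub]
  have hlow : w m * cutUp A (m + 1) ≤ ∑ i ∈ lowerIndices N (m + 1), w i *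
      ((∑ j, A i j * if m + 1 ≤ (j : ℕ) then 1 else 0) - if m + 1 ≤ (i : ℕ) then 1 else 0) := by
    rw [cutUp, mul_sum]
    refine sum_le_sum fun i hi => ?_
    rw [mem_lowerIndices] at hi
    rw [hin, if_neg (by omega), sub_zero]
    exact mul_le_mul_of_nonneg_right (hanti (by omega)) (sum_nonneg fun _ _ => hA _ _)
  have hhigh : -(w (m + 1) * cutDown A (m + 1)) ≤
      ∑ i ∈ lowerIndices N l \ lowerIndices N (m + 1), w i *
      ((∑ j, A i j * if m + 1 ≤ (j : ℕ) then 1 else 0) - if m + 1 ≤ (i : ℕ) then 1 else 0) := by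
    have h1 : ∑ i ∈ lowerIndices N l \ lowerIndices N (m + 1),
        w (m + 1) * ∑ j ∈ lowerIndices N (m + 1), A i j ≤ w (m + 1) * cutDown A (m + 1) := by
      rw [cutDown, mul_sum]
      refine sum_le_sum_of_subset_of_nonneg (fun i hi => ?_) fun i _ _ =>
        mul_nonneg (hw _) (sum_nonneg fun _ _ => hA _ _)
      exact mem_compl.2 (mem_sdiff.1 hi).2
    refine (neg_le_neg h1).trans ?_
    rw [← sum_neg_distrib]
    refine sum_le_sum fun i hi => ?_
    have hi' : m + 1 ≤ (i : ℕ) := by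
      have := (mem_sdiff.1 hi).2
      rw [mem_lowerIndices] at this
      omega
    rw [hin, if_pos hi', hout, mul_neg]
    exact neg_le_neg (mul_le_mul_of_nonneg_right (hanti hi') (sum_nonneg fun _ _ => hA _ _))
  have h2 : w (m + 1) * cutDown A (m + 1) ≤ w m * cutUp A (m + 1) :=
    calc w (m + 1) * cutDown A (m + 1) ≤ w (m + 1) * (M * cutUp A (m + 1)) :=
          mul_le_mul_of_nonneg_left hcut (hw _)
      _ = M * w (m + 1) * cutUp A (m + 1) := by ring
      _ ≤ w m * cutUp A (m + 1) := mul_le_mul_of_nonneg_right hwM (cutUp_nonneg hA _)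
  linarith

/-- A weighted sum of the `l + 1` smallest coordinates grows by at least the flow through the cut
above them times the gap at that cut. -/
lemma weighted_sum_growth {N : ℕ} {A : Matrix (Fin N) (Fin N) ℝ} (hA : ∀ i j, 0 ≤ A i j)
    (hrow : ∀ i, ∑ j, A i j = 1) {M : ℝ} {w : ℕ → ℝ} (hw : ∀ i, 0 ≤ w i) (hanti : Antitone w)
    {l : ℕ} (hl : l + 1 < N) (hwM : ∀ m < l, M * w (m + 1) ≤ w m)
    (hcut : ∀ m, m + 1 < N → cutDown A (m + 1) ≤ M * cutUp A (m + 1))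
    {z : Fin N → ℝ} (hz : Monotone z) :
    ∑ i ∈ lowerIndices N (l + 1), w i * z i +
        w l * cutUp A (l + 1) * (z ⟨l + 1, hl⟩ - z ⟨l, by omega⟩) ≤
      ∑ i ∈ lowerIndices N (l + 1), w i * ∑ j, A i j * z j := by
  obtain ⟨c, d, hd0, hd, hdec, hdz⟩ := exists_increments z hz
  set drift : ℕ → ℝ := fun m => ∑ i ∈ lowerIndices N (l + 1), w i *
    ((∑ j, A i j * if m ≤ (j : ℕ) then 1 else 0) - if m ≤ (i : ℕ) then 1 else 0) with hdrift
  have hexp : ∑ i ∈ lowerIndices N (l + 1), w i * ∑ j, A i j * z j -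
      ∑ i ∈ lowerIndices N (l + 1), w i * z i = ∑ m ∈ range N, d m * drift m := by
    have hrowz : ∀ i, ∑ j, A i j * z j - z i = ∑ m ∈ range N, d m *
        ((∑ j, A i j * if m ≤ (j : ℕ) then 1 else 0) - if m ≤ (i : ℕ) then 1 else 0) := fun i => by
      have h1 : ∑ j, A i j * z j = c + ∑ m ∈ range N, d m *
          ∑ j, A i j * if m ≤ (j : ℕ) then 1 else 0 := by
        simp_rw [hdec, mul_add, sum_add_distrib, ← sum_mul, hrow, one_mul, mul_sum]
        rw [sum_comm]
        simp_rw [mul_left_comm]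
      rw [h1, hdec i]
      simp_rw [mul_sub, sum_sub_distrib]
      ring
    rw [← sum_sub_distrib]
    simp_rw [← mul_sub, hrowz, hdrift, mul_sum]
    rw [sum_comm]
    simp_rw [mul_left_comm]
  have hnonneg : ∀ m ∈ range N, 0 ≤ d m * drift m := fun m hm => by
    rcases m with _ | m
    · simp [hd0]
    refine mul_nonneg (hd _) ?_
    by_cases hml : m + 1 < l + 1
    · exact indicator_drift_nonneg hA hrow hw hanti (hwM m (by omega)) hml
        (hcut m (mem_range.1 hm))
    · refine sum_nonneg fun i hi => mul_nonneg (hw _) ?_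
      rw [mem_lowerIndices] at hi
      rw [if_neg (by omega), sub_zero]
      exact sum_nonneg fun j _ => mul_nonneg (hA _ _) (by split_ifs <;> norm_num)
  have hsingle := single_le_sum hnonneg (mem_range.2 hl)
  have hmain : w l * cutUp A (l + 1) ≤ drift (l + 1) := by
    rw [cutUp, mul_sum]
    refine sum_le_sum fun i hi => ?_
    rw [mem_lowerIndices] at hi
    rw [sum_mul_upper_indicator, if_neg (by omega), sub_zero]
    exact mul_le_mul_of_nonneg_right (hanti (by omega)) (sum_nonneg fun _ _ => hA _ _)
  have := mul_le_mul_of_nonneg_left hmain (hd (l + 1))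
  rw [← hdz l hl]
  linarith

/-- A lower bound on all coordinates persists under row-stochastic averaging. -/
lemma lower_bound_persists {ι : Type*} [Fintype ι] {A : ℕ → Matrix ι ι ℝ}
    (hA : ∀ t i j, 0 ≤ A t i j) (hrow : ∀ t i, ∑ j, A t i j = 1) {z : ℕ → ι → ℝ}
    (hz : ∀ t i, z (t + 1) i = ∑ j, A t i j * z t j) {c : ℝ} {a b : ℕ} (hab : a ≤ b)
    (hc : ∀ i, c ≤ z a i) : ∀ i, c ≤ z b i := by
  induction b, hab using Nat.le_induction with
  | base => exact hc
  | succ k _ ih =>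
    intro i
    calc c = ∑ j, A k i j * c := by rw [← sum_mul, hrow, one_mul]
      _ ≤ ∑ j, A k i j * z k j := sum_le_sum fun j _ => mul_le_mul_of_nonneg_left (ih j) (hA _ _ _)
      _ = z (k + 1) i := (hz k i).symm

/-- The value just above a cut loses at most the fraction of weight flowing down the cut. -/
lemma upper_value_decay {N : ℕ} {A : Matrix (Fin N) (Fin N) ℝ} (hA : ∀ i j, 0 ≤ A i j)
    (hrow : ∀ i, ∑ j, A i j = 1) {z : Fin N → ℝ} (hz : Monotone z) (hz0 : ∀ i, 0 ≤ z i)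
    (i : Fin N) : (1 - cutDown A i) * z i ≤ ∑ j, A i j * z j := by
  have h1 : ∑ j ∈ lowerIndices N i, A i j ≤ cutDown A i :=
    single_le_sum (f := fun i' => ∑ j ∈ lowerIndices N i, A i' j)
      (fun _ _ => sum_nonneg fun _ _ => hA _ _) (mem_compl_lowerIndices.2 le_rfl)
  have h2 : ∑ j ∈ (lowerIndices N i)ᶜ, A i j = 1 - ∑ j ∈ lowerIndices N i, A i j := by
    rw [← hrow i, ← sum_add_sum_compl (lowerIndices N i)]
    ring
  calc (1 - cutDown A i) * z i ≤ (∑ j ∈ (lowerIndices N i)ᶜ, A i j) * z i :=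
        mul_le_mul_of_nonneg_right (by linarith) (hz0 i)
    _ = ∑ j ∈ (lowerIndices N i)ᶜ, A i j * z i := sum_mul _ _ _
    _ ≤ ∑ j ∈ (lowerIndices N i)ᶜ, A i j * z j := sum_le_sum fun j hj =>
        mul_le_mul_of_nonneg_left (hz (Fin.le_def.2 (mem_compl_lowerIndices.1 hj))) (hA _ _)
    _ ≤ ∑ j, A i j * z j := sum_le_sum_of_subset_of_nonneg (subset_univ _)
        fun j _ _ => mul_nonneg (hA _ _) (hz0 j)

/-- If the coordinate just above a cut is at least `α` and a unit of weight flows down the cut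
during `[a, b)`, then at time `b` some coordinate below the cut is large. -/
lemma exists_lifted_lower_value {N : ℕ} {A : ℕ → Matrix (Fin N) (Fin N) ℝ}
    (hA : ∀ t i j, 0 ≤ A t i j) (hrow : ∀ t i, ∑ j, A t i j = 1) {M : ℝ} (hM : 1 ≤ M)
    (hcut : ∀ t m, m + 1 < N → cutDown (A t) (m + 1) ≤ M * cutUp (A t) (m + 1))
    {z : ℕ → Fin N → ℝ} (hz : ∀ t i, z (t + 1) i = ∑ j, A t i j * z t j)
    (hmono : ∀ t, Monotone (z t)) {a b : ℕ} (hab : a ≤ b) (hz0 : ∀ i, 0 ≤ z a i)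
    {l : ℕ} (hl : l + 1 < N) {δ : ℝ} (hδ : 0 < δ) (hlδ : 8 * (l + 1) * δ * M ≤ 1)
    (hflow : 1 ≤ ∑ k ∈ Ico a b, cutDown (A k) (l + 1))
    {α : ℝ} (hα : 0 ≤ α) (hzα : α ≤ z a ⟨l + 1, hl⟩) :
    ∃ (m : ℕ) (hm : m ≤ l), α * δ ^ (l + 1 - m) ≤ z b ⟨m, by omega⟩ := by
  by_contra! hcon
  have hM0 : 0 < M := by linarith
  have hδM : δ * M ≤ 1 := by
    have : 0 ≤ (l : ℝ) * (δ * M) := by positivity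
    have : 0 < δ * M := by positivity
    nlinarith
  have hδ1 : δ ≤ 1 := by nlinarith
  set w : ℕ → ℝ := fun i => δ⁻¹ ^ (l - i) with hwdef
  have hw : ∀ i, 0 ≤ w i := fun i => by positivity
  have hanti : Antitone w := fun i j hij =>
    pow_le_pow_right₀ (one_le_inv_iff₀.2 ⟨hδ, hδ1⟩) (by omega)
  have hwM : ∀ m < l, M * w (m + 1) ≤ w m := fun m hm => by
    have h1 : l - m = l - (m + 1) + 1 := by omega
    simp only [hwdef]
    rw [h1, pow_succ, mul_comm]
    refine mul_le_mul_of_nonneg_left ?_ (by positivity)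
    rw [← one_div, le_div_iff₀ hδ]
    linarith
  have hwl : w l = 1 := by simp [hwdef]
  set V : ℕ → ℝ := fun k => ∑ i ∈ lowerIndices N (l + 1), w i * z k i with hV
  have hnn : ∀ k, a ≤ k → ∀ i, 0 ≤ z k i := fun k hk => lower_bound_persists hA hrow hz hk hz0
  have hgrow : ∀ k, V k + cutUp (A k) (l + 1) * (z k ⟨l + 1, hl⟩ - z k ⟨l, by omega⟩) ≤
      V (k + 1) := fun k => by
    have := weighted_sum_growth (hA k) (hrow k) hw hanti hl hwM (hcut k) (hmono k)
    rw [hwl, one_mul] at this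
    simpa only [hV, hz k] using this
  have hgap : ∀ k, 0 ≤ z k ⟨l + 1, hl⟩ - z k ⟨l, by omega⟩ := fun k =>
    sub_nonneg.2 (hmono k (by simp [Fin.le_def]))
  have hVmono : Monotone V := monotone_nat_of_le_succ fun k => by
    have := mul_nonneg (cutUp_nonneg (hA k) (l + 1)) (hgap k)
    linarith [hgrow k]
  have hVb : V b < (l + 1) * (α * δ) := by
    have hterm : ∀ i ∈ lowerIndices N (l + 1), w i * z b i < α * δ := fun i hi => by
      rw [mem_lowerIndices] at hi
      have h1 := hcon i (by omega)
      have h2 : l + 1 - (i : ℕ) = l - i + 1 := by omega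
      have h3 : w i * δ ^ (l - (i : ℕ)) = 1 := by
        simp only [hwdef]
        rw [← mul_pow, inv_mul_cancel₀ hδ.ne', one_pow]
      have h4 : 0 < w i := by simp only [hwdef]; positivity
      calc w i * z b i < w i * (α * δ ^ (l + 1 - (i : ℕ))) := mul_lt_mul_of_pos_left h1 h4
        _ = w i * δ ^ (l - (i : ℕ)) * (α * δ) := by rw [h2, pow_succ]; ring
        _ = α * δ := by rw [h3, one_mul]
    have hne : (lowerIndices N (l + 1)).Nonempty :=
      ⟨⟨l, by omega⟩, mem_lowerIndices.2 (Nat.lt_succ_self l)⟩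
    have := sum_lt_sum_of_nonempty hne hterm
    rw [sum_const, card_lowerIndices hl.le, nsmul_eq_mul] at this
    exact_mod_cast this
  have hsmall : (l + 1) * (α * δ) ≤ α / (8 * M) := by
    rw [le_div_iff₀ (by positivity)]
    nlinarith
  have hsmall' : α / (8 * M) ≤ α / 8 := by gcongr; linarith
  have hzl : ∀ k, a ≤ k → k ≤ b → z k ⟨l, by omega⟩ ≤ α / 8 := fun k hak hkb => by
    have h1 : w l * z k ⟨l, by omega⟩ ≤ V k :=
      single_le_sum (f := fun i : Fin N => w i * z k i)
        (fun i _ => mul_nonneg (hw _) (hnn k hak i))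
        (mem_lowerIndices.2 (Nat.lt_succ_self l) : (⟨l, by omega⟩ : Fin N) ∈ _)
    rw [hwl, one_mul] at h1
    linarith [hVmono hkb]
  have hG : ∀ k, 0 ≤ ∑ k ∈ Ico a k, cutDown (A k) (l + 1) := fun k =>
    sum_nonneg fun _ _ => cutDown_nonneg (hA _) _
  have hind : ∀ k, a ≤ k → k ≤ b →
      (∑ k ∈ Ico a k, cutDown (A k) (l + 1) ≤ 1 / 2 →
        α * (1 - ∑ k ∈ Ico a k, cutDown (A k) (l + 1)) ≤ z k ⟨l + 1, hl⟩) ∧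
      3 * α / (8 * M) * min (∑ k ∈ Ico a k, cutDown (A k) (l + 1)) (1 / 2) ≤ V k := by
    intro k hak
    induction k, hak using Nat.le_induction with
    | base =>
      refine fun _ => ⟨fun _ => by simpa using hzα, ?_⟩
      simpa using sum_nonneg fun i _ => mul_nonneg (hw _) (hz0 i)
    | succ k hak ih =>
      intro hkb
      obtain ⟨ih1, ih2⟩ := ih (by omega)
      rw [sum_Ico_succ_top hak]
      have hGk := hG k
      set G := ∑ k ∈ Ico a k, cutDown (A k) (l + 1)
      have hg := cutDown_nonneg (hA k) (l + 1)
      set g := cutDown (A k) (l + 1) with hgdef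
      refine ⟨fun hGg => ?_, ?_⟩
      · have h1 := ih1 (by linarith)
        have h2 := upper_value_decay (hA k) (hrow k) (hmono k) (hnn k hak) ⟨l + 1, hl⟩
        rw [← hz k] at h2
        refine le_trans ?_ h2
        change _ ≤ (1 - g) * _
        calc α * (1 - (G + g)) ≤ (1 - g) * (α * (1 - G)) := by
              nlinarith [mul_nonneg hα (mul_nonneg hGk hg)]
          _ ≤ _ := mul_le_mul_of_nonneg_left h1 (by linarith)
      · have hc : 0 ≤ 3 * α / (8 * M) := by positivity
        by_cases hGhalf : G ≤ 1 / 2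
        · have h1 := ih1 hGhalf
          have h2 : 3 * α / 8 ≤ z k ⟨l + 1, hl⟩ - z k ⟨l, by omega⟩ := by
            have := hzl k hak (by omega)
            nlinarith
          have h3 : g / M ≤ cutUp (A k) (l + 1) := by
            rw [div_le_iff₀ hM0, mul_comm]
            exact hcut k l hl
          have h4 : g / M * (3 * α / 8) ≤
              cutUp (A k) (l + 1) * (z k ⟨l + 1, hl⟩ - z k ⟨l, by omega⟩) :=
            mul_le_mul h3 h2 (by positivity) (cutUp_nonneg (hA k) _)
          rw [min_eq_left hGhalf] at ih2
          calc 3 * α / (8 * M) * min (G + g) (1 / 2) ≤ 3 * α / (8 * M) * (G + g) :=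
                mul_le_mul_of_nonneg_left (min_le_left _ _) hc
            _ = 3 * α / (8 * M) * G + g / M * (3 * α / 8) := by field_simp
            _ ≤ V (k + 1) := by linarith [hgrow k]
        · rw [min_eq_right (by linarith)] at ih2 ⊢
          exact ih2.trans (hVmono (Nat.le_succ k))
  have hfin := (hind b hab le_rfl).2
  rw [min_eq_right (by linarith)] at hfin
  have : 3 * α / (8 * M) * (1 / 2) = 3 / 2 * (α / (8 * M)) := by ring
  have : 0 ≤ α / (8 * M) := by positivity
  linarith

/-- Lifting one more of the smallest coordinates on each of `P` successive intervals. -/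
lemma sorted_lower_bound {N : ℕ} {A : ℕ → Matrix (Fin N) (Fin N) ℝ}
    (hA : ∀ t i j, 0 ≤ A t i j) (hrow : ∀ t i, ∑ j, A t i j = 1) {M : ℝ} (hM : 1 ≤ M)
    (hcut : ∀ t m, m + 1 < N → cutDown (A t) (m + 1) ≤ M * cutUp (A t) (m + 1))
    {z : ℕ → Fin N → ℝ} (hz : ∀ t i, z (t + 1) i = ∑ j, A t i j * z t j)
    (hmono : ∀ t, Monotone (z t)) {τ : ℕ → ℕ} {P : ℕ} (hP : P < N)
    (hτ : ∀ q < P, τ q < τ (q + 1)) (hz0 : ∀ i, 0 ≤ z (τ 0) i)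
    {δ : ℝ} (hδ : 0 < δ) (hPδ : 8 * P * δ * M ≤ 1)
    (hflow : ∀ q < P, ∀ l, l + 1 < N →
      1 ≤ ∑ k ∈ Ico (τ q) (τ (q + 1)), cutDown (A k) (l + 1))
    {α : ℝ} (hα : 0 ≤ α) (hzα : α ≤ z (τ 0) ⟨P, hP⟩) (i : Fin N) :
    α * δ ^ P ≤ z (τ P) i := by
  have hind : ∀ q ≤ P, (∀ i, 0 ≤ z (τ q) i) ∧
      ∃ (l : ℕ) (hl : l ≤ P - q), α * δ ^ (P - l) ≤ z (τ q) ⟨l, by omega⟩ := by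
    intro q
    induction q with
    | zero => exact fun _ => ⟨hz0, P, by omega, by simpa using hzα⟩
    | succ q ih =>
      intro hq
      obtain ⟨hnn, l, hl, hzl⟩ := ih (by omega)
      have hlt := hτ q (by omega)
      refine ⟨lower_bound_persists hA hrow hz hlt.le hnn, ?_⟩
      rcases l with _ | l
      · exact ⟨0, by omega, lower_bound_persists hA hrow hz hlt.le
          (fun i => hzl.trans (hmono _ (Fin.le_def.2 (Nat.zero_le _)))) _⟩
      · have hlP : ((l + 1 : ℕ) : ℝ) ≤ P := by exact_mod_cast (by omega : l + 1 ≤ P)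
        push_cast at hlP
        have hlδ : 8 * ((l : ℝ) + 1) * δ * M ≤ 1 := le_trans (by gcongr) hPδ
        obtain ⟨m, hm, hzm⟩ := exists_lifted_lower_value hA hrow hM hcut hz hmono hlt.le hnn
          (by omega) hδ hlδ (hflow q (by omega) l (by omega)) (by positivity) hzl
        refine ⟨m, by omega, le_of_eq_of_le ?_ hzm⟩
        rw [mul_assoc, ← pow_add]
        congr 2
        omega
  obtain ⟨-, l, hl, hzl⟩ := hind P le_rfl
  obtain rfl : l = 0 := by omega
  exact hzl.trans (hmono _ (Fin.le_def.2 (Nat.zero_le _)))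

/-- If at most `P` entries are below `v`, then the entry of rank `P` is at least `v`. -/
lemma le_sort_of_card_lt_le {N P : ℕ} (hP : P < N) (x : Fin N → ℝ) {v : ℝ}
    (hcard : (univ.filter fun i => x i < v).card ≤ P) : v ≤ x (Tuple.sort x ⟨P, hP⟩) := by
  by_contra! h
  have hsub : (lowerIndices N (P + 1)).map (Tuple.sort x).toEmbedding ⊆
      univ.filter fun i => x i < v := by
    intro i hi
    obtain ⟨j, hj, rfl⟩ := mem_map.1 hi
    rw [mem_lowerIndices] at hj
    have : (x ∘ Tuple.sort x) j ≤ (x ∘ Tuple.sort x) ⟨P, hP⟩ :=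
      Tuple.monotone_sort x (Fin.le_def.2 (by simp only; omega))
    exact mem_filter.2 ⟨mem_univ _, this.trans_lt h⟩
  have := card_le_card hsub
  rw [card_map, card_lowerIndices (by omega)] at this
  omega

/-- Lower bound at the end of the last interval for a nonnegative solution, at most half of
whose entries start below `α`. -/
lemma lower_bound_of_flow {N : ℕ} (hN : 2 ≤ N) {M : ℝ} (hM : 1 ≤ M)
    {B : ℕ → Matrix (Fin N) (Fin N) ℝ}
    (hnonneg : ∀ t i j, 0 ≤ B t i j)
    (hrow : ∀ t i, ∑ j, B t i j = 1)
    (hbal : ∀ t : ℕ, ∀ S1 S2 : Finset (Fin N), S1.Nonempty → S1 ≠ Finset.univ →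
      S2.Nonempty → S2 ≠ Finset.univ → S1.card = S2.card →
      ∑ i ∈ S1ᶜ, ∑ j ∈ S2, B t i j ≤ M * ∑ i ∈ S1, ∑ j ∈ S2ᶜ, B t i j)
    {y : ℕ → Fin N → ℝ} (hy : ∀ t i, y (t + 1) i = ∑ j, B t i j * y t j) {τ : ℕ → ℕ}
    (hτmono : ∀ q < N / 2, τ q < τ (q + 1))
    (hflow : ∀ q < N / 2, ∀ S : ℕ → Finset (Fin N),
      (∀ k, τ q ≤ k → k ≤ τ (q + 1) → (S k).Nonempty ∧ S k ≠ Finset.univ) →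
      (∀ k, τ q ≤ k → k ≤ τ (q + 1) → (S k).card = (S (τ q)).card) →
      1 ≤ ∑ k ∈ Finset.Ico (τ q) (τ (q + 1)), ∑ i ∈ (S (k + 1))ᶜ, ∑ j ∈ S k, B k i j)
    (hy0 : ∀ i, 0 ≤ y (τ 0) i) {α : ℝ} (hα : 0 ≤ α)
    (hcard : (univ.filter fun i => y (τ 0) i < α).card ≤ N / 2) (i : Fin N) :
    α * (1 / (4 * (N : ℝ) ^ 2 * M)) ^ (N / 2) ≤ y (τ (N / 2)) i := by
  set σ : ℕ → Equiv.Perm (Fin N) := fun t => Tuple.sort (y t) with hσ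
  set A : ℕ → Matrix (Fin N) (Fin N) ℝ := fun t => (B t).submatrix (σ (t + 1)) (σ t) with hA
  set S : ℕ → ℕ → Finset (Fin N) := fun l t => (lowerIndices N l).map (σ t).toEmbedding with hS
  have hScompl : ∀ l t, (S l t)ᶜ = (lowerIndices N l)ᶜ.map (σ t).toEmbedding := fun l t => by
    ext i
    simp [hS]
  have hSne : ∀ l t, l + 1 < N → (S (l + 1) t).Nonempty := fun l t hl =>
    Finset.Nonempty.map ⟨⟨l, by omega⟩, mem_lowerIndices.2 (Nat.lt_succ_self l)⟩
  have hScard : ∀ l t, l + 1 < N → (S (l + 1) t).card = l + 1 := fun l t hl => by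
    simp only [hS, card_map, card_lowerIndices hl.le]
  have hSuniv : ∀ l t, l + 1 < N → S (l + 1) t ≠ univ := fun l t hl h => by
    have := hScard l t hl
    rw [h, card_univ, Fintype.card_fin] at this
    omega
  have hdown : ∀ l t, cutDown (A t) l = ∑ i ∈ (S l (t + 1))ᶜ, ∑ j ∈ S l t, B t i j :=
    fun l t => by
      rw [hScompl]
      simp [hS, cutDown, hA]
  have hup : ∀ l t, cutUp (A t) l = ∑ i ∈ S l (t + 1), ∑ j ∈ (S l t)ᶜ, B t i j :=
    fun l t => by
      rw [hScompl]
      simp [hS, cutUp, hA]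
  have hN0 : (2 : ℝ) ≤ N := by exact_mod_cast hN
  have hhalf : ((N / 2 : ℕ) : ℝ) ≤ N / 2 := Nat.cast_div_le
  have key := sorted_lower_bound (A := A) (z := fun t i => y t (σ t i)) (P := N / 2)
    (fun t i j => hnonneg _ _ _)
    (fun t i => (Equiv.sum_comp (σ t) fun j => B t (σ (t + 1) i) j).trans (hrow _ _)) hM
    (fun t m hm => by
      rw [hdown, hup]
      exact hbal t _ _ (hSne m _ hm) (hSuniv m _ hm) (hSne m _ hm) (hSuniv m _ hm)
        ((hScard m _ hm).trans (hScard m _ hm).symm))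
    (fun t i => (hy t _).trans (Equiv.sum_comp (σ t) fun j => B t (σ (t + 1) i) j * y t j).symm)
    (fun t => Tuple.monotone_sort (y t)) (by omega) hτmono (fun i => hy0 _)
    (δ := 1 / (4 * (N : ℝ) ^ 2 * M)) (by positivity)
    (by
      rw [show 8 * ((N / 2 : ℕ) : ℝ) * (1 / (4 * (N : ℝ) ^ 2 * M)) * M =
        2 * ((N / 2 : ℕ) : ℝ) / (N : ℝ) ^ 2 by field_simp; ring, div_le_one (by positivity)]
      nlinarith)
    (fun q hq l hl => by
      simp only [hdown]
      exact hflow q hq (S (l + 1)) (fun k _ _ => ⟨hSne l k hl, hSuniv l k hl⟩)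
        fun k _ _ => (hScard l k hl).trans (hScard l _ hl).symm)
    hα (le_sort_of_card_lt_le _ _ hcard) ((σ (τ (N / 2))).symm i)
  simpa using key

theorem stmt14 (N : ℕ) (hN : 2 ≤ N) (M : ℝ) (hM : 1 ≤ M)
    (B : ℕ → Matrix (Fin N) (Fin N) ℝ)
    (hnonneg : ∀ t i j, 0 ≤ B t i j)
    (hrow : ∀ t i, ∑ j, B t i j = 1)
    (hbal : ∀ t : ℕ, ∀ S1 S2 : Finset (Fin N), S1.Nonempty → S1 ≠ Finset.univ →
      S2.Nonempty → S2 ≠ Finset.univ → S1.card = S2.card →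
      ∑ i ∈ S1ᶜ, ∑ j ∈ S2, B t i j ≤ M * ∑ i ∈ S1, ∑ j ∈ S2ᶜ, B t i j)
    (y : ℕ → Fin N → ℝ)
    (hy : ∀ t i, y (t + 1) i = ∑ j, B t i j * y t j)
    (s t : ℕ) (τ : ℕ → ℕ)
    (hτ0 : τ 0 = s) (hτP : τ (N / 2) = t)
    (hτmono : ∀ q < N / 2, τ q < τ (q + 1))
    (hflow : ∀ q < N / 2, ∀ S : ℕ → Finset (Fin N),
      (∀ k, τ q ≤ k → k ≤ τ (q + 1) → (S k).Nonempty ∧ S k ≠ Finset.univ) →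
      (∀ k, τ q ≤ k → k ≤ τ (q + 1) → (S k).card = (S (τ q)).card) →
      1 ≤ ∑ k ∈ Finset.Ico (τ q) (τ (q + 1)), ∑ i ∈ (S (k + 1))ᶜ, ∑ j ∈ S k, B k i j) :
    (⨆ i, y t i) - (⨅ i, y t i) ≤
      (1 - (M ^ (N / 2))⁻¹ / (8 * (N : ℝ) ^ 2) ^ (N / 2)) *
        ((⨆ i, y s i) - (⨅ i, y s i)) := by
  subst hτ0 hτP
  have : Nonempty (Fin N) := ⟨⟨0, by omega⟩⟩
  have hN0 : (2 : ℝ) ≤ N := by exact_mod_cast hN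
  set U := ⨆ i, y (τ 0) i with hU
  set L := ⨅ i, y (τ 0) i with hL
  have hyU : ∀ i, y (τ 0) i ≤ U := fun i => le_ciSup (Set.finite_range _).bddAbove i
  have hyL : ∀ i, L ≤ y (τ 0) i := fun i => ciInf_le (Set.finite_range _).bddBelow i
  have hLU : L ≤ U := (hyL ⟨0, by omega⟩).trans (hyU _)
  have hle : τ 0 ≤ τ (N / 2) := by
    have : ∀ q ≤ N / 2, τ 0 ≤ τ q := fun q => by
      induction q with
      | zero => exact fun _ => le_rfl
      | succ q ih => exact fun hq => (ih (by omega)).trans (hτmono q (by omega)).le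
    exact this _ le_rfl
  have hyLow : ∀ t i, y (t + 1) i - L = ∑ j, B t i j * (y t j - L) := fun t i => by
    simp_rw [mul_sub, sum_sub_distrib, ← sum_mul, hrow, one_mul, hy]
  have hyUp : ∀ t i, U - y (t + 1) i = ∑ j, B t i j * (U - y t j) := fun t i => by
    simp_rw [mul_sub, sum_sub_distrib, ← sum_mul, hrow, one_mul, hy]
  have hLt : ∀ i, L ≤ y (τ (N / 2)) i := lower_bound_persists hnonneg hrow hy hle hyL
  have hUt : ∀ i, 0 ≤ U - y (τ (N / 2)) i :=
    lower_bound_persists (z := fun t i => U - y t i) hnonneg hrow hyUp hle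
      fun i => sub_nonneg.2 (hyU i)
  set c := (M ^ (N / 2))⁻¹ / (8 * (N : ℝ) ^ 2) ^ (N / 2) with hc
  have hconst : c * (U - L) ≤ (U - L) / 2 * (1 / (4 * (N : ℝ) ^ 2 * M)) ^ (N / 2) := by
    have h1 : (1 / (4 * (N : ℝ) ^ 2 * M)) ^ (N / 2) = 2 ^ (N / 2) * c := by
      rw [hc, show 8 * (N : ℝ) ^ 2 = 2 * (4 * (N : ℝ) ^ 2) by ring, div_pow, one_pow, mul_pow,
        mul_pow 2]
      field_simp
    have h2 : (2 : ℝ) ≤ 2 ^ (N / 2) := by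
      simpa using pow_le_pow_right₀ (one_le_two (α := ℝ)) (by omega : 1 ≤ N / 2)
    have h3 : 0 ≤ c * (U - L) := mul_nonneg (by positivity) (by linarith)
    rw [h1]
    nlinarith
  have hα : 0 ≤ (U - L) / 2 := by linarith
  by_cases hcard : (univ.filter fun i => y (τ 0) i - L < (U - L) / 2).card ≤ N / 2
  · have hlow := lower_bound_of_flow (y := fun t i => y t i - L) hN hM hnonneg hrow hbal hyLow
      hτmono hflow (fun i => sub_nonneg.2 (hyL i)) hα hcard
    have h1 : (⨆ i, y (τ (N / 2)) i) ≤ U := ciSup_le fun i => sub_nonneg.1 (hUt i)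
    have h2 : L + c * (U - L) ≤ ⨅ i, y (τ (N / 2)) i := le_ciInf fun i => by linarith [hlow i]
    linarith
  · have hcard' : (univ.filter fun i => U - y (τ 0) i < (U - L) / 2).card ≤ N / 2 := by
      have hdisj : Disjoint (univ.filter fun i => y (τ 0) i - L < (U - L) / 2)
          (univ.filter fun i => U - y (τ 0) i < (U - L) / 2) :=
        disjoint_filter.2 fun i _ h1 h2 => by linarith
      have := (card_union_of_disjoint hdisj).symm.trans_le (card_le_univ _)
      rw [Fintype.card_fin] at this
      omega
    have hup := lower_bound_of_flow (y := fun t i => U - y t i) hN hM hnonneg hrow hbal hyUp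
      hτmono hflow (fun i => sub_nonneg.2 (hyU i)) hα hcard'
    have h1 : (⨆ i, y (τ (N / 2)) i) ≤ U - c * (U - L) := ciSup_le fun i => by linarith [hup i]
    have h2 : L ≤ ⨅ i, y (τ (N / 2)) i := le_ciInf hLt
    linarith
end

section
/- Consider the system y(t+1) = B(t) y(t), where each B(t) is an N×N row-stochastic matrix with b_ii(t) ≥ γ for all i and t, for some constant γ > 0, and each B(t) satisfies the cut-balance condition with a common constant M* ≥ 1. Suppose the persistent graph G_p' (whose arcs are the pairs (j,i) with ∑_{t=0}^∞ b_ij(t) = ∞) contains a directed spanning tree. Then global consensus is reached, and moreover, setting M = max{M*, (N−1)/γ} and P = ⌊N/2⌋, for any integers s = τ_0 < τ_1 < ⋯ < τ_P = t such that for each q ∈ {0,…,P−1} and every sequence S(τ_q), …, S(τ_{q+1}) of nonempty proper subsets of {1,…,N} with the same cardinality ∑_{k=τ_q}^{τ_{q+1}−1} ∑_{i∉S(k+1), j∈S(k)} b_ij(k) ≥ 1, one has Φ(t) ≤ (1 − M^{−⌊N/2⌋}/(8N²)^{⌊N/2⌋}) Φ(s). -/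
open Filter Finset

/-- Summation by parts on an initial segment, with the partial sums of `c` as coefficients. -/
lemma sum_range_succ_mul_eq_sub (c w : ℕ → ℝ) (n : ℕ) :
    ∑ j ∈ range (n + 1), c j * w j =
      (∑ j ∈ range (n + 1), c j) * w n -
        ∑ l ∈ range n, (∑ j ∈ range (l + 1), c j) * (w (l + 1) - w l) := by
  induction n with
  | zero => simp
  | succ n ih =>
    rw [sum_range_succ, ih, sum_range_succ (fun l => _ * (w (l + 1) - w l)) n,
      sum_range_succ c (n + 1)]
    ring

/-- A linear functional of total mass zero whose partial sums are nonpositive is nonnegative on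
monotone sequences; each single layer bounds it from below. -/
lemma neg_partialSum_mul_le_sum_mul {N : ℕ} {c w : ℕ → ℝ} (hw : Monotone w)
    (hc : ∀ l, 0 < l → l < N → ∑ j ∈ range l, c j ≤ 0) (hc0 : ∑ j ∈ range N, c j = 0)
    {n : ℕ} (hn : 0 < n) (hnN : n < N) :
    (-∑ j ∈ range n, c j) * (w n - w (n - 1)) ≤ ∑ j ∈ range N, c j * w j := by
  obtain ⟨N, rfl⟩ : ∃ K, N = K + 1 := ⟨N - 1, by omega⟩
  obtain ⟨n, rfl⟩ : ∃ K, n = K + 1 := ⟨n - 1, by omega⟩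
  rw [sum_range_succ_mul_eq_sub, hc0, zero_mul, zero_sub, Nat.add_sub_cancel, neg_mul,
    ← sum_neg_distrib]
  refine single_le_sum (f := fun l => -((∑ j ∈ range (l + 1), c j) * (w (l + 1) - w l)))
    (fun l hl => ?_) (mem_range.2 (by omega : n < N))
  have h1 := hc (l + 1) (by omega) (by have := mem_range.1 hl; omega)
  have h2 := hw (Nat.le_succ l)
  simp only [Nat.succ_eq_add_one] at h2
  nlinarith

/-- The sorted states `w k` of a row-stochastic flow, with the weight matrices `a k` expressed in
sorted coordinates and balanced, with constant `M`, across every initial segment. -/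
structure IsSortedFlow (N : ℕ) (M : ℝ) (a : ℕ → ℕ → ℕ → ℝ) (w : ℕ → ℕ → ℝ) : Prop where
  one_le : 1 ≤ M
  nonneg : ∀ k i j, 0 ≤ a k i j
  row : ∀ k i, i < N → ∑ j ∈ range N, a k i j = 1
  step : ∀ k i, i < N → w (k + 1) i = ∑ j ∈ range N, a k i j * w k j
  mono : ∀ k, Monotone (w k)
  balance : ∀ k l, 0 < l → l < N → ∑ i ∈ Ico l N, ∑ j ∈ range l, a k i j ≤
    M * ∑ i ∈ range l, ∑ j ∈ Ico l N, a k i j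

namespace IsSortedFlow

/-- Geometrically weighted sum of the `n` smallest entries. -/
noncomputable def lowSum (M : ℝ) (w : ℕ → ℝ) (n : ℕ) : ℝ := ∑ i ∈ range n, M⁻¹ ^ i * w i

/-- Total weight with which the `n` smallest nodes listen to the others. -/
noncomputable def inflow (N : ℕ) (a : ℕ → ℕ → ℝ) (n : ℕ) : ℝ :=
  ∑ i ∈ range n, ∑ j ∈ Ico n N, a i j

variable {N : ℕ} {M : ℝ} {a : ℕ → ℕ → ℕ → ℝ} {w : ℕ → ℕ → ℝ}

lemma inflow_nonneg (h : IsSortedFlow N M a w) (k n : ℕ) : 0 ≤ inflow N (a k) n :=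
  sum_nonneg fun _ _ => sum_nonneg fun _ _ => h.nonneg _ _ _

lemma M_pos (h : IsSortedFlow N M a w) : 0 < M := zero_lt_one.trans_le h.one_le

lemma pow_inv_pos (h : IsSortedFlow N M a w) (i : ℕ) : 0 < M⁻¹ ^ i :=
  pow_pos (inv_pos.2 h.M_pos) i

lemma pow_inv_anti (h : IsSortedFlow N M a w) {i j : ℕ} (hij : i ≤ j) : M⁻¹ ^ j ≤ M⁻¹ ^ i :=
  pow_le_pow_of_le_one (inv_nonneg.2 h.M_pos.le) (inv_le_one_of_one_le₀ h.one_le) hij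

lemma row_head (h : IsSortedFlow N M a w) (k : ℕ) {i l : ℕ} (hi : i < N) (hl : l ≤ N) :
    ∑ j ∈ range l, a k i j = 1 - ∑ j ∈ Ico l N, a k i j := by
  rw [← h.row k i hi, ← sum_range_add_sum_Ico _ hl]; ring

lemma le_weighted_inflow (h : IsSortedFlow N M a w) (k : ℕ) {l : ℕ} (hl : 0 < l) :
    M⁻¹ ^ (l - 1) * inflow N (a k) l ≤
      ∑ i ∈ range l, M⁻¹ ^ i * ∑ j ∈ Ico l N, a k i j := by
  rw [inflow, mul_sum]
  refine sum_le_sum fun i hi => mul_le_mul_of_nonneg_right (h.pow_inv_anti ?_)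
    (sum_nonneg fun _ _ => h.nonneg _ _ _)
  have := mem_range.1 hi
  omega

lemma lowSum_step_coeff (h : IsSortedFlow N M a w) (k : ℕ) {n : ℕ} (hn : n ≤ N) :
    lowSum M (w (k + 1)) n - lowSum M (w k) n = ∑ j ∈ range N,
      ((∑ i ∈ range n, M⁻¹ ^ i * a k i j) - if j < n then M⁻¹ ^ j else 0) * w k j := by
  have h1 : lowSum M (w k) n = ∑ j ∈ range N, (if j < n then M⁻¹ ^ j else 0) * w k j := by
    simp only [ite_mul, zero_mul]
    rw [← sum_filter, lowSum]
    congr 1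
    ext j; simp; omega
  have h2 : lowSum M (w (k + 1)) n =
      ∑ j ∈ range N, (∑ i ∈ range n, M⁻¹ ^ i * a k i j) * w k j := by
    simp only [sum_mul]
    rw [sum_comm, lowSum]
    refine sum_congr rfl fun i hi => ?_
    rw [h.step k i (by have := mem_range.1 hi; omega), mul_sum]
    exact sum_congr rfl fun _ _ => by ring
  rw [h1, h2, ← sum_sub_distrib]
  exact sum_congr rfl fun _ _ => by ring

lemma partialSum_coeff (h : IsSortedFlow N M a w) (k n : ℕ) {l : ℕ} (hl : l ≤ N) :
    ∑ j ∈ range l, ((∑ i ∈ range n, M⁻¹ ^ i * a k i j) - if j < n then M⁻¹ ^ j else 0) =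
      (∑ i ∈ Ico l n, M⁻¹ ^ i * ∑ j ∈ range l, a k i j) -
        ∑ i ∈ range (min l n), M⁻¹ ^ i * ∑ j ∈ Ico l N, a k i j := by
  have h1 : ∑ j ∈ range l, (if j < n then M⁻¹ ^ j else 0) = ∑ i ∈ range (min l n), M⁻¹ ^ i := by
    rw [← sum_filter]
    congr 1
    ext j; simp
  have h2 : ∑ i ∈ range n, M⁻¹ ^ i * ∑ j ∈ range l, a k i j =
      (∑ i ∈ range (min l n), M⁻¹ ^ i * ∑ j ∈ range l, a k i j) +
        ∑ i ∈ Ico l n, M⁻¹ ^ i * ∑ j ∈ range l, a k i j := by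
    rw [← sum_range_add_sum_Ico _ (min_le_right l n)]
    congr 2
    ext i; simp; omega
  have h3 : ∑ i ∈ range (min l n), M⁻¹ ^ i * ∑ j ∈ range l, a k i j =
      ∑ i ∈ range (min l n), (M⁻¹ ^ i - M⁻¹ ^ i * ∑ j ∈ Ico l N, a k i j) := by
    refine sum_congr rfl fun i hi => ?_
    rw [h.row_head k (by have := mem_range.1 hi; omega) hl]; ring
  rw [sum_sub_distrib, h1, sum_comm]
  simp only [← mul_sum]
  rw [h2, h3, sum_sub_distrib]
  ring

lemma partialSum_coeff_nonpos (h : IsSortedFlow N M a w) (k : ℕ) {n l : ℕ} (hn : n ≤ N)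
    (hl : 0 < l) (hlN : l < N) :
    ∑ j ∈ range l, ((∑ i ∈ range n, M⁻¹ ^ i * a k i j) - if j < n then M⁻¹ ^ j else 0) ≤ 0 := by
  rw [h.partialSum_coeff k n hlN.le]
  rcases le_or_gt n l with hnl | hnl
  · rw [Ico_eq_empty_of_le hnl, sum_empty, zero_sub, neg_nonpos]
    exact sum_nonneg fun i _ => mul_nonneg (h.pow_inv_pos i).le
      (sum_nonneg fun _ _ => h.nonneg _ _ _)
  · rw [min_eq_left hnl.le, sub_nonpos]
    refine le_trans ?_ (h.le_weighted_inflow k hl)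
    have hb := h.balance k l hl hlN
    calc ∑ i ∈ Ico l n, M⁻¹ ^ i * ∑ j ∈ range l, a k i j
        ≤ ∑ i ∈ Ico l N, M⁻¹ ^ l * ∑ j ∈ range l, a k i j := by
          refine (sum_le_sum fun i hi => mul_le_mul_of_nonneg_right
            (h.pow_inv_anti (mem_Ico.1 hi).1) (sum_nonneg fun _ _ => h.nonneg _ _ _)).trans ?_
          exact sum_le_sum_of_subset_of_nonneg (Ico_subset_Ico_right hn) fun i _ _ =>
            mul_nonneg (h.pow_inv_pos l).le (sum_nonneg fun _ _ => h.nonneg _ _ _)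
      _ ≤ M⁻¹ ^ l * (M * inflow N (a k) l) := by
          rw [← mul_sum]
          exact mul_le_mul_of_nonneg_left hb (h.pow_inv_pos l).le
      _ = M⁻¹ ^ (l - 1) * inflow N (a k) l := by
          obtain ⟨l, rfl⟩ : ∃ m, l = m + 1 := ⟨l - 1, by omega⟩
          have := h.M_pos.ne'
          rw [Nat.add_sub_cancel, pow_succ]
          field_simp

lemma sum_coeff_eq_zero (h : IsSortedFlow N M a w) (k : ℕ) {n : ℕ} (hn : n ≤ N) :
    ∑ j ∈ range N, ((∑ i ∈ range n, M⁻¹ ^ i * a k i j) - if j < n then M⁻¹ ^ j else 0) = 0 := by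
  rw [h.partialSum_coeff k n le_rfl]
  simp [Ico_eq_empty_of_le hn]

lemma inflow_mul_gap_le (h : IsSortedFlow N M a w) (k : ℕ) {n : ℕ} (hn : 0 < n) (hnN : n < N) :
    M⁻¹ ^ (n - 1) * inflow N (a k) n * (w k n - w k (n - 1)) ≤
      lowSum M (w (k + 1)) n - lowSum M (w k) n := by
  rw [h.lowSum_step_coeff k hnN.le]
  refine le_trans ?_ (neg_partialSum_mul_le_sum_mul (h.mono k)
    (fun l hl hlN => h.partialSum_coeff_nonpos k hnN.le hl hlN)
    (h.sum_coeff_eq_zero k hnN.le) hn hnN)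
  refine mul_le_mul_of_nonneg_right ?_ (sub_nonneg.2 (h.mono k (Nat.sub_le n 1)))
  rw [h.partialSum_coeff k n hnN.le]
  simpa using h.le_weighted_inflow k hn

lemma lowSum_monotone (h : IsSortedFlow N M a w) (hN : 2 ≤ N) {n : ℕ} (hn : n ≤ N) :
    Monotone fun k => lowSum M (w k) n := by
  refine monotone_nat_of_le_succ fun k => ?_
  rw [← sub_nonneg, h.lowSum_step_coeff k hn]
  refine le_trans ?_ (neg_partialSum_mul_le_sum_mul (h.mono k)
    (fun l hl hlN => h.partialSum_coeff_nonpos k hn hl hlN)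
    (h.sum_coeff_eq_zero k hn) one_pos (by omega))
  exact mul_nonneg (neg_nonneg.2 (h.partialSum_coeff_nonpos k hn one_pos (by omega)))
    (sub_nonneg.2 (h.mono k (Nat.sub_le 1 1)))

/-- Accumulated inflow across a persistent gap raises the weighted sum of the low entries. -/
lemma sum_inflow_mul_le (h : IsSortedFlow N M a w) {n : ℕ} (hn : 0 < n) (hnN : n < N)
    {s t : ℕ} (hst : s ≤ t) {δ : ℝ} (hδ : ∀ k ∈ Ico s t, δ ≤ w k n - w k (n - 1)) :
    M⁻¹ ^ (n - 1) * δ * ∑ k ∈ Ico s t, inflow N (a k) n ≤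
      lowSum M (w t) n - lowSum M (w s) n := by
  rw [← sum_Ico_sub (fun k => lowSum M (w k) n) hst, mul_sum]
  refine sum_le_sum fun k hk => le_trans ?_ (h.inflow_mul_gap_le k hn hnN)
  have := mul_le_mul_of_nonneg_left (hδ k hk)
    (mul_nonneg (h.pow_inv_pos (n - 1)).le (h.inflow_nonneg k n))
  linarith

lemma head_monotone (h : IsSortedFlow N M a w) (hN : 2 ≤ N) : Monotone fun k => w k 0 := by
  have := h.lowSum_monotone hN (n := 1) (by omega)
  simpa [lowSum] using this

lemma state_nonneg (h : IsSortedFlow N M a w) (hN : 2 ≤ N) {s t : ℕ} (hst : s ≤ t)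
    (h0 : 0 ≤ w s 0) (i : ℕ) : 0 ≤ w t i :=
  (h0.trans (h.head_monotone hN hst)).trans (h.mono t (Nat.zero_le i))

/-- Over a window carrying unit inflow into the `m` smallest nodes, these inherit a definite share
of the value at position `m`. -/
lemma quarter_le_lowSum (h : IsSortedFlow N M a w) {m : ℕ} (hm : 0 < m) (hmN : m < N)
    {s t : ℕ} (hst : s ≤ t) (h0 : 0 ≤ w s 0) {β : ℝ} (hβ : 0 ≤ β) (hw : β ≤ w s m)
    (hin : 1 ≤ ∑ k ∈ Ico s t, inflow N (a k) m) :
    M⁻¹ ^ m * β / 4 ≤ lowSum M (w t) m := by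
  have hN : 2 ≤ N := by omega
  by_contra! hlt
  have hx := h.pow_inv_pos m
  have hx' := h.pow_inv_pos (m - 1)
  have hxx : M⁻¹ ^ m ≤ M⁻¹ ^ (m - 1) := h.pow_inv_anti (Nat.sub_le m 1)
  have hDs : 0 ≤ lowSum M (w s) m :=
    sum_nonneg fun i _ => mul_nonneg (h.pow_inv_pos i).le (h.state_nonneg hN le_rfl h0 i)
  have hgap : ∀ k ∈ Ico s t, β / 2 ≤ w k m - w k (m - 1) := by
    intro k hk
    obtain ⟨hsk, hkt⟩ := mem_Ico.1 hk
    have h1 : lowSum M (w k) m ≤ lowSum M (w t) m := h.lowSum_monotone hN hmN.le hkt.le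
    have h2 : lowSum M (w s) (m + 1) ≤ lowSum M (w k) (m + 1) := h.lowSum_monotone hN hmN hsk
    have h3 (k : ℕ) : lowSum M (w k) (m + 1) = lowSum M (w k) m + M⁻¹ ^ m * w k m :=
      sum_range_succ _ _
    rw [h3, h3] at h2
    have h4 : M⁻¹ ^ (m - 1) * w k (m - 1) ≤ lowSum M (w k) m :=
      single_le_sum (f := fun i => M⁻¹ ^ i * w k i)
        (fun i _ => mul_nonneg (h.pow_inv_pos i).le (h.state_nonneg hN hsk h0 i))
        (mem_range.2 (by omega))
    have h5 : w k (m - 1) ≤ β / 4 := by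
      refine le_of_mul_le_mul_left ?_ hx'
      nlinarith
    have h6 : 3 / 4 * β ≤ w k m := by
      refine le_of_mul_le_mul_left ?_ hx
      nlinarith
    linarith
  have hsum := h.sum_inflow_mul_le hm hmN hst hgap
  have h7 : M⁻¹ ^ (m - 1) * (β / 2) ≤
      M⁻¹ ^ (m - 1) * (β / 2) * ∑ k ∈ Ico s t, inflow N (a k) m :=
    le_mul_of_one_le_right (by positivity) hin
  have h8 := mul_le_mul_of_nonneg_right hxx hβ
  nlinarith [mul_nonneg hx.le hβ]

lemma exists_lower_index (h : IsSortedFlow N M a w) {m : ℕ} (hm : 0 < m) (hmN : m < N)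
    {s t : ℕ} (hst : s ≤ t) (h0 : 0 ≤ w s 0) {β : ℝ} (hβ : 0 ≤ β) (hw : β ≤ w s m)
    (hin : 1 ≤ ∑ k ∈ Ico s t, inflow N (a k) m) :
    ∃ i < m, (4 * N * M)⁻¹ ^ (m - i) * β ≤ w t i := by
  have hq := h.quarter_le_lowSum hm hmN hst h0 hβ hw hin
  by_contra! hlt
  have hNpos : (1 : ℝ) ≤ N := by exact_mod_cast (by omega : 1 ≤ N)
  have hM := h.M_pos
  have hterm : ∀ i ∈ range m, M⁻¹ ^ i * w t i < M⁻¹ ^ m * β / (4 * N) := by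
    intro i hi
    have him := mem_range.1 hi
    refine (mul_lt_mul_of_pos_left (hlt i him) (h.pow_inv_pos i)).trans_le ?_
    have e : M⁻¹ ^ m = M⁻¹ ^ i * M⁻¹ ^ (m - i) := by rw [← pow_add]; congr 1; omega
    have e2 : ((4 : ℝ) * N)⁻¹ ^ (m - i) ≤ ((4 : ℝ) * N)⁻¹ := by
      refine pow_le_of_le_one (by positivity) (inv_le_one_of_one_le₀ (by linarith)) (by omega)
    rw [mul_inv, mul_pow, e]
    have e3 := mul_le_mul_of_nonneg_left e2
      (mul_nonneg (mul_nonneg (h.pow_inv_pos i).le (h.pow_inv_pos (m - i)).le) hβ)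
    calc _ = M⁻¹ ^ i * M⁻¹ ^ (m - i) * β * ((4 : ℝ) * N)⁻¹ ^ (m - i) := by ring
      _ ≤ _ := e3
      _ = _ := by rw [div_eq_mul_inv]
  have hsum : lowSum M (w t) m < ∑ _i ∈ range m, M⁻¹ ^ m * β / (4 * N) :=
    sum_lt_sum_of_nonempty ⟨0, mem_range.2 hm⟩ hterm
  rw [sum_const, card_range, nsmul_eq_mul] at hsum
  have hmN' : (m : ℝ) ≤ N := by exact_mod_cast hmN.le
  have : (m : ℝ) * (M⁻¹ ^ m * β / (4 * N)) ≤ N * (M⁻¹ ^ m * β / (4 * N)) :=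
    mul_le_mul_of_nonneg_right hmN' (by positivity)
  have e : (N : ℝ) * (M⁻¹ ^ m * β / (4 * N)) = M⁻¹ ^ m * β / 4 := by field_simp
  linarith

/-- Unit-inflow windows lower, one by one, the position at which a definite value is present. -/
lemma exists_index_of_windows (h : IsSortedFlow N M a w) (hN : 2 ≤ N) {P : ℕ} (hPN : P < N)
    {τ : ℕ → ℕ} {Q : ℕ} (hτ : ∀ q < Q, τ q < τ (q + 1)) (h0 : 0 ≤ w (τ 0) 0) {α : ℝ} (hα : 0 ≤ α)
    (hw : α ≤ w (τ 0) P)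
    (hin : ∀ q < Q, ∀ m, 0 < m → m < N →
      1 ≤ ∑ k ∈ Ico (τ q) (τ (q + 1)), inflow N (a k) m) :
    ∀ q ≤ Q, 0 ≤ w (τ q) 0 ∧ ∃ m ≤ P - q, (4 * N * M)⁻¹ ^ (P - m) * α ≤ w (τ q) m := by
  have hM := h.M_pos
  intro q
  induction q with
  | zero => exact fun _ => ⟨h0, P, by simp, by simpa using hw⟩
  | succ q ih =>
    intro hq
    obtain ⟨hnn, m, hm, hwm⟩ := ih (by omega)
    have hlt := hτ q (by omega)
    refine ⟨hnn.trans (h.head_monotone hN hlt.le), ?_⟩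
    rcases Nat.eq_zero_or_pos m with rfl | hmpos
    · exact ⟨0, Nat.zero_le _, hwm.trans (h.head_monotone hN hlt.le)⟩
    · obtain ⟨i, him, hi⟩ := h.exists_lower_index hmpos (by omega) hlt.le hnn (by positivity) hwm
        (hin q (by omega) m hmpos (by omega))
      refine ⟨i, by omega, le_trans (le_of_eq ?_) hi⟩
      rw [← mul_assoc, ← pow_add]
      congr 2
      omega

end IsSortedFlow

section Sorting

variable {N : ℕ} (hN : 0 < N) (y : Fin N → ℝ)

/-- The node carrying the `j`-th smallest value of `y`, for `j < N`. -/
noncomputable def sortedNode (j : ℕ) : Fin N := Tuple.sort y ⟨min j (N - 1), by omega⟩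

/-- The nodes carrying the `n` smallest values of `y`. -/
noncomputable def lowSet (n : ℕ) : Finset (Fin N) := (range n).image (sortedNode hN y)

lemma monotone_sortedNode : Monotone fun j => y (sortedNode hN y j) := fun _ _ hij =>
  Tuple.monotone_sort y (Fin.mk_le_mk.2 (min_le_min_right _ hij))

lemma sortedNode_inj {i j : ℕ} (hi : i < N) (hj : j < N)
    (h : sortedNode hN y i = sortedNode hN y j) : i = j := by
  have := congrArg Fin.val ((Tuple.sort y).injective h)
  simp only at this
  omega

lemma exists_sortedNode_eq (i : Fin N) : ∃ j < N, sortedNode hN y j = i := by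
  refine ⟨((Tuple.sort y).symm i).val, Fin.is_lt _, ?_⟩
  have : (⟨min ((Tuple.sort y).symm i).val (N - 1), by omega⟩ : Fin N) = (Tuple.sort y).symm i :=
    Fin.ext (by simp only; omega)
  rw [sortedNode, this, Equiv.apply_symm_apply]

lemma mem_lowSet_sortedNode {j n : ℕ} (hj : j < N) (hn : n ≤ N) :
    sortedNode hN y j ∈ lowSet hN y n ↔ j < n := by
  refine ⟨fun h => ?_, fun h => mem_image_of_mem _ (mem_range.2 h)⟩
  obtain ⟨i, hi, hij⟩ := mem_image.1 h
  have hi := mem_range.1 hi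
  rwa [← sortedNode_inj hN y (hi.trans_le hn) hj hij]

lemma card_lowSet {n : ℕ} (hn : n ≤ N) : (lowSet hN y n).card = n := by
  rw [lowSet, card_image_of_injOn, card_range]
  intro i hi j hj h
  simp only [coe_range, Set.mem_Iio] at hi hj
  exact sortedNode_inj hN y (by omega) (by omega) h

lemma compl_lowSet {n : ℕ} (hn : n ≤ N) :
    (lowSet hN y n)ᶜ = (Ico n N).image (sortedNode hN y) := by
  ext i
  obtain ⟨j, hj, rfl⟩ := exists_sortedNode_eq hN y i
  rw [mem_compl, mem_lowSet_sortedNode hN y hj hn, mem_image]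
  constructor
  · exact fun h => ⟨j, mem_Ico.2 ⟨not_lt.1 h, hj⟩, rfl⟩
  · rintro ⟨i, hi, hij⟩
    obtain ⟨h1, h2⟩ := mem_Ico.1 hi
    rw [← sortedNode_inj hN y h2 hj hij]
    exact not_lt.2 h1

lemma sum_lowSet {n : ℕ} (hn : n ≤ N) (f : Fin N → ℝ) :
    ∑ i ∈ lowSet hN y n, f i = ∑ j ∈ range n, f (sortedNode hN y j) := by
  rw [lowSet, sum_image]
  intro i hi j hj h
  simp only [coe_range, Set.mem_Iio] at hi hj
  exact sortedNode_inj hN y (by omega) (by omega) h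

lemma sum_compl_lowSet {n : ℕ} (hn : n ≤ N) (f : Fin N → ℝ) :
    ∑ i ∈ (lowSet hN y n)ᶜ, f i = ∑ j ∈ Ico n N, f (sortedNode hN y j) := by
  rw [compl_lowSet hN y hn, sum_image]
  intro i hi j hj h
  simp only [coe_Ico, Set.mem_Ico] at hi hj
  exact sortedNode_inj hN y hi.2 hj.2 h

lemma sum_sortedNode (f : Fin N → ℝ) :
    ∑ j ∈ range N, f (sortedNode hN y j) = ∑ i, f i := by
  rw [← sum_lowSet hN y le_rfl]
  congr 1
  exact eq_univ_of_card _ (by rw [card_lowSet hN y le_rfl, Fintype.card_fin])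

lemma lowSet_nonempty {n : ℕ} (hn : 0 < n) : (lowSet hN y n).Nonempty :=
  (nonempty_range_iff.2 hn.ne').image _

lemma lowSet_ne_univ {n : ℕ} (hn : n < N) : lowSet hN y n ≠ univ := fun h => by
  have := card_lowSet hN y hn.le
  rw [h, card_univ, Fintype.card_fin] at this
  omega

lemma le_sortedNode_of_card {P : ℕ} (hP : P < N) {v : ℝ}
    (hv : N - P ≤ (univ.filter fun i => v ≤ y i).card) : v ≤ y (sortedNode hN y P) := by
  by_contra! hlt
  have hsub : (univ.filter fun i => v ≤ y i) ⊆ (lowSet hN y (P + 1))ᶜ := by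
    intro i hi
    rw [mem_compl]
    intro hmem
    obtain ⟨j, hj, rfl⟩ := mem_image.1 hmem
    have h1 : y (sortedNode hN y j) ≤ y (sortedNode hN y P) :=
      monotone_sortedNode hN y (Nat.lt_succ_iff.1 (mem_range.1 hj))
    have h2 := (mem_filter.1 hi).2
    linarith
  have := card_le_card hsub
  rw [card_compl, card_lowSet hN y hP, Fintype.card_fin] at this
  omega

end Sorting

/-- Row-stochastic matrices with diagonal at least `γ`, each cut-balanced with constant `K`. -/
structure IsCutBalanced {N : ℕ} (γ K : ℝ) (B : ℕ → Matrix (Fin N) (Fin N) ℝ) : Prop where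
  pos : 0 < γ
  one_le : 1 ≤ K
  nonneg : ∀ t i j, 0 ≤ B t i j
  row : ∀ t i, ∑ j, B t i j = 1
  diag : ∀ t i, γ ≤ B t i i
  cut : ∀ t : ℕ, ∀ S : Finset (Fin N), S.Nonempty → S ≠ Finset.univ →
      ∑ i ∈ Sᶜ, ∑ j ∈ S, B t i j ≤ K * ∑ i ∈ S, ∑ j ∈ Sᶜ, B t i j

namespace IsCutBalanced

variable {N : ℕ} {γ K : ℝ} {B : ℕ → Matrix (Fin N) (Fin N) ℝ}

lemma diag_le_of_ne (h : IsCutBalanced γ K B) (t : ℕ) {S S' : Finset (Fin N)}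
    (hcard : S'.card = S.card) (hne : S' ≠ S) : γ ≤ ∑ i ∈ S', ∑ j ∈ Sᶜ, B t i j := by
  obtain ⟨i, hi, hi'⟩ : ∃ i ∈ S', i ∉ S := by
    by_contra! hsub
    exact hne (eq_of_subset_of_card_le hsub hcard.ge)
  calc γ ≤ B t i i := h.diag t i
    _ ≤ ∑ j ∈ Sᶜ, B t i j :=
        single_le_sum (f := fun j => B t i j) (fun j _ => h.nonneg t i j) (mem_compl.2 hi')
    _ ≤ _ := single_le_sum (f := fun i => ∑ j ∈ Sᶜ, B t i j)
        (fun i _ => sum_nonneg fun j _ => h.nonneg t i j) hi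

/-- The balance persists when the cut is replaced by another one of the same cardinality. -/
lemma moving_cut (h : IsCutBalanced γ K B) (t : ℕ) {S S' : Finset (Fin N)}
    (hcard : S'.card = S.card) (hS : S.Nonempty) (hS' : S ≠ univ) :
    ∑ i ∈ S'ᶜ, ∑ j ∈ S, B t i j ≤
      max K (((N : ℝ) - 1) / γ) * ∑ i ∈ S', ∑ j ∈ Sᶜ, B t i j := by
  have hnn : 0 ≤ ∑ i ∈ S', ∑ j ∈ Sᶜ, B t i j :=
    sum_nonneg fun i _ => sum_nonneg fun j _ => h.nonneg t i j
  by_cases hne : S' = S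
  · subst hne
    exact (h.cut t S' hS hS').trans (mul_le_mul_of_nonneg_right (le_max_left _ _) hnn)
  · have hγ := h.pos
    have hpos : 0 < S'.card := hcard ▸ hS.card_pos
    have hN : (1 : ℝ) ≤ N := by
      have := card_le_univ S'
      rw [Fintype.card_fin] at this
      exact_mod_cast hpos.trans_le this
    calc ∑ i ∈ S'ᶜ, ∑ j ∈ S, B t i j ≤ ∑ i ∈ S'ᶜ, (1 : ℝ) :=
          sum_le_sum fun i _ => (h.row t i) ▸
            sum_le_sum_of_subset_of_nonneg (subset_univ S) fun j _ _ => h.nonneg t i j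
      _ = (S'ᶜ.card : ℝ) := by simp
      _ ≤ (N : ℝ) - 1 := by
          have : S'ᶜ.card + 1 ≤ N := by
            have := card_le_univ S'
            rw [Fintype.card_fin] at this
            rw [card_compl, Fintype.card_fin]
            omega
          have : ((S'ᶜ.card : ℝ)) + 1 ≤ N := by exact_mod_cast this
          linarith
      _ = ((N : ℝ) - 1) / γ * γ := by field_simp
      _ ≤ _ := mul_le_mul (le_max_right _ _) (h.diag_le_of_ne t hcard hne) hγ.le
          (zero_le_one.trans (h.one_le.trans (le_max_left _ _)))

variable (hN : 0 < N) {y : ℕ → Fin N → ℝ}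

/-- The weight matrix at time `k` with rows and columns sorted by the states at times `k + 1`
and `k`. -/
noncomputable def sortedWeights (B : ℕ → Matrix (Fin N) (Fin N) ℝ) (y : ℕ → Fin N → ℝ)
    (k i j : ℕ) : ℝ := B k (sortedNode hN (y (k + 1)) i) (sortedNode hN (y k) j)

/-- The state at time `k` in increasing order. -/
noncomputable def sortedState (y : ℕ → Fin N → ℝ) (k j : ℕ) : ℝ := y k (sortedNode hN (y k) j)

lemma inflow_sortedWeights (y : ℕ → Fin N → ℝ) (k : ℕ) {n : ℕ} (hn : n ≤ N) :
    IsSortedFlow.inflow N (sortedWeights hN B y k) n =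
      ∑ i ∈ lowSet hN (y (k + 1)) n, ∑ j ∈ (lowSet hN (y k) n)ᶜ, B k i j := by
  rw [sum_lowSet hN _ hn]
  simp only [sum_compl_lowSet hN _ hn]
  rfl

lemma outflow_sortedWeights (y : ℕ → Fin N → ℝ) (k : ℕ) {n : ℕ} (hn : n ≤ N) :
    ∑ i ∈ Ico n N, ∑ j ∈ range n, sortedWeights hN B y k i j =
      ∑ i ∈ (lowSet hN (y (k + 1)) n)ᶜ, ∑ j ∈ lowSet hN (y k) n, B k i j := by
  rw [sum_compl_lowSet hN _ hn]
  simp only [sum_lowSet hN _ hn]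
  rfl

lemma isSortedFlow (h : IsCutBalanced γ K B) (hy : ∀ t i, y (t + 1) i = ∑ j, B t i j * y t j) :
    IsSortedFlow N (max K (((N : ℝ) - 1) / γ)) (sortedWeights hN B y) (sortedState hN y) where
  one_le := h.one_le.trans (le_max_left _ _)
  nonneg _ _ _ := h.nonneg _ _ _
  row k i _ := by
    rw [← h.row k (sortedNode hN (y (k + 1)) i)]
    exact sum_sortedNode hN (y k) (fun j => B k (sortedNode hN (y (k + 1)) i) j)
  step k i _ := by
    rw [sortedState, hy]
    exact (sum_sortedNode hN (y k)
      (fun j => B k (sortedNode hN (y (k + 1)) i) j * y k j)).symm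
  mono k := monotone_sortedNode hN (y k)
  balance k l hl hlN := by
    rw [outflow_sortedWeights hN y k hlN.le]
    refine (h.moving_cut k ?_ (lowSet_nonempty hN _ hl) (lowSet_ne_univ hN _ hlN)).trans_eq ?_
    · rw [card_lowSet hN _ hlN.le, card_lowSet hN _ hlN.le]
    · rw [← inflow_sortedWeights hN y k hlN.le]
      rfl

lemma sortedState_zero_le (y : ℕ → Fin N → ℝ) (k : ℕ) (i : Fin N) :
    sortedState hN y k 0 ≤ y k i := by
  obtain ⟨j, _, rfl⟩ := exists_sortedNode_eq hN (y k) i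
  exact monotone_sortedNode hN (y k) (Nat.zero_le j)

lemma le_sortedState_last (y : ℕ → Fin N → ℝ) (k : ℕ) (i : Fin N) :
    y k i ≤ sortedState hN y k (N - 1) := by
  obtain ⟨j, hj, rfl⟩ := exists_sortedNode_eq hN (y k) i
  exact monotone_sortedNode hN (y k) (by omega : j ≤ N - 1)

/-- If at least half of the nodes start `α` above a lower bound `b`, then after `⌊N/2⌋` windows all
nodes are above `b` by a definite fraction of `α`. -/
lemma lower_bound_of_windows (h : IsCutBalanced γ K B) (hN2 : 2 ≤ N)
    (hy : ∀ t i, y (t + 1) i = ∑ j, B t i j * y t j) {τ : ℕ → ℕ}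
    (hτ : ∀ q < N / 2, τ q < τ (q + 1))
    (hS : ∀ q < N / 2, ∀ S : ℕ → Finset (Fin N),
      (∀ k, τ q ≤ k → k ≤ τ (q + 1) → (S k).Nonempty ∧ S k ≠ Finset.univ) →
      (∀ k, τ q ≤ k → k ≤ τ (q + 1) → (S k).card = (S (τ q)).card) →
      1 ≤ ∑ k ∈ Finset.Ico (τ q) (τ (q + 1)), ∑ i ∈ (S (k + 1))ᶜ, ∑ j ∈ S k, B k i j)
    {b α : ℝ} (hα : 0 ≤ α) (hb : ∀ i, b ≤ y (τ 0) i)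
    (hcard : N - N / 2 ≤ (univ.filter fun i => b + α ≤ y (τ 0) i).card) (i : Fin N) :
    b + (4 * N * max K (((N : ℝ) - 1) / γ))⁻¹ ^ (N / 2) * α ≤ y (τ (N / 2)) i := by
  have hN : 0 < N := by omega
  set z : ℕ → Fin N → ℝ := fun t i => y t i - b with hz
  have hzy : ∀ t i, z (t + 1) i = ∑ j, B t i j * z t j := fun t i => by
    simp only [hz, mul_sub, sum_sub_distrib, ← sum_mul, h.row, one_mul, hy]
  have hflow := h.isSortedFlow hN hzy
  have hmed : α ≤ sortedState hN z (τ 0) (N / 2) := by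
    refine le_sortedNode_of_card hN _ (by omega) ?_
    simpa only [hz, le_sub_iff_add_le'] using hcard
  have hin : ∀ q < N / 2, ∀ m, 0 < m → m < N →
      1 ≤ ∑ k ∈ Ico (τ q) (τ (q + 1)),
        IsSortedFlow.inflow N (sortedWeights hN B z k) m := by
    intro q hq m hm hmN
    refine (hS q hq (fun k => (lowSet hN (z k) m)ᶜ) (fun k _ _ => ⟨?_, ?_⟩)
      (fun k _ _ => ?_)).trans_eq (sum_congr rfl fun k _ => ?_)
    · rw [← card_pos, card_compl, card_lowSet hN _ hmN.le, Fintype.card_fin]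
      omega
    · rw [Ne, compl_eq_univ_iff]
      exact (lowSet_nonempty hN _ hm).ne_empty
    · rw [card_compl, card_compl, card_lowSet hN _ hmN.le, card_lowSet hN _ hmN.le]
    · rw [inflow_sortedWeights hN z k hmN.le, compl_compl]
  obtain ⟨-, m, hm, hle⟩ := hflow.exists_index_of_windows hN2 (by omega : N / 2 < N) hτ
    (sub_nonneg.2 (hb _)) hα hmed hin (N / 2) le_rfl
  obtain rfl : m = 0 := by omega
  have := hle.trans (sortedState_zero_le hN z (τ (N / 2)) i)
  simp only [hz, Nat.sub_zero] at this
  linarith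

end IsCutBalanced

namespace IsCutBalanced

variable {N : ℕ} {γ K : ℝ} {B : ℕ → Matrix (Fin N) (Fin N) ℝ} {y : ℕ → Fin N → ℝ}

lemma neg_flow (hy : ∀ t i, y (t + 1) i = ∑ j, B t i j * y t j) (t : ℕ) (i : Fin N) :
    (-y) (t + 1) i = ∑ j, B t i j * (-y) t j := by
  simp [hy]

lemma lower_bound_preserved (h : IsCutBalanced γ K B)
    (hy : ∀ t i, y (t + 1) i = ∑ j, B t i j * y t j) {s t : ℕ} (hst : s ≤ t) {b : ℝ}
    (hb : ∀ i, b ≤ y s i) : ∀ i, b ≤ y t i := by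
  induction t, hst using Nat.le_induction with
  | base => exact hb
  | succ t _ ih =>
    intro i
    rw [hy, ← one_mul b, ← h.row t i, sum_mul]
    exact sum_le_sum fun j _ => mul_le_mul_of_nonneg_left (ih j) (h.nonneg t i j)

lemma upper_bound_preserved (h : IsCutBalanced γ K B)
    (hy : ∀ t i, y (t + 1) i = ∑ j, B t i j * y t j) {s t : ℕ} (hst : s ≤ t) {b : ℝ}
    (hb : ∀ i, y s i ≤ b) (i : Fin N) : y t i ≤ b :=
  neg_le_neg_iff.1 (h.lower_bound_preserved (neg_flow hy) hst (fun i => neg_le_neg (hb i)) i)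

lemma contraction_factor_le {M Φ : ℝ} (hM : 1 ≤ M) (hΦ : 0 ≤ Φ) (hN : 2 ≤ N) :
    (M ^ (N / 2))⁻¹ / (8 * (N : ℝ) ^ 2) ^ (N / 2) * Φ ≤
      (4 * N * M)⁻¹ ^ (N / 2) * (Φ / 2) := by
  have hN' : (1 : ℝ) ≤ N := by exact_mod_cast (by omega : 1 ≤ N)
  have hP : N / 2 ≠ 0 := by omega
  generalize N / 2 = P at *
  have e : (M ^ P)⁻¹ / (8 * (N : ℝ) ^ 2) ^ P = (4 * N * M)⁻¹ ^ P * (2 * (N : ℝ))⁻¹ ^ P := by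
    rw [div_eq_mul_inv, ← inv_pow, ← inv_pow, ← mul_pow, ← mul_pow, ← mul_inv, ← mul_inv]
    ring_nf
  have h2 : (2 * (N : ℝ))⁻¹ ^ P ≤ 1 / 2 := by
    have h3 : (2 * (N : ℝ))⁻¹ ≤ 2⁻¹ := inv_anti₀ two_pos (by linarith)
    refine (pow_le_of_le_one (by positivity) (h3.trans (by norm_num)) hP).trans ?_
    linarith
  rw [e, mul_assoc]
  refine mul_le_mul_of_nonneg_left ?_ (by positivity)
  nlinarith

lemma contraction (h : IsCutBalanced γ K B) (hN2 : 2 ≤ N)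
    (hy : ∀ t i, y (t + 1) i = ∑ j, B t i j * y t j) {τ : ℕ → ℕ}
    (hτ : ∀ q < N / 2, τ q < τ (q + 1))
    (hS : ∀ q < N / 2, ∀ S : ℕ → Finset (Fin N),
      (∀ k, τ q ≤ k → k ≤ τ (q + 1) → (S k).Nonempty ∧ S k ≠ Finset.univ) →
      (∀ k, τ q ≤ k → k ≤ τ (q + 1) → (S k).card = (S (τ q)).card) →
      1 ≤ ∑ k ∈ Finset.Ico (τ q) (τ (q + 1)), ∑ i ∈ (S (k + 1))ᶜ, ∑ j ∈ S k, B k i j) :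
    (⨆ i, y (τ (N / 2)) i) - (⨅ i, y (τ (N / 2)) i) ≤
      (1 - ((max K (((N : ℝ) - 1) / γ)) ^ (N / 2))⁻¹ / (8 * (N : ℝ) ^ 2) ^ (N / 2)) *
        ((⨆ i, y (τ 0) i) - (⨅ i, y (τ 0) i)) := by
  have : Nonempty (Fin N) := ⟨⟨0, by omega⟩⟩
  have hle : τ 0 ≤ τ (N / 2) := by
    have : ∀ q ≤ N / 2, τ 0 ≤ τ q := by
      intro q
      induction q with
      | zero => exact fun _ => le_rfl
      | succ q ih => exact fun hq => (ih (by omega)).trans (hτ q hq).le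
    exact this _ le_rfl
  set b := ⨅ i, y (τ 0) i
  set u := ⨆ i, y (τ 0) i
  have hbi (i : Fin N) : b ≤ y (τ 0) i := ciInf_le (Set.finite_range _).bddBelow i
  have hui (i : Fin N) : y (τ 0) i ≤ u := le_ciSup (Set.finite_range _).bddAbove i
  have hΦ : 0 ≤ u - b := sub_nonneg.2 ((hbi Classical.ofNonempty).trans (hui _))
  have hc := contraction_factor_le (h.one_le.trans (le_max_left K (((N : ℝ) - 1) / γ))) hΦ hN2
  by_cases hcard : N - N / 2 ≤ (univ.filter fun i => b + (u - b) / 2 ≤ y (τ 0) i).card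
  · have h1 := le_ciInf (h.lower_bound_of_windows hN2 hy hτ hS (by linarith) hbi hcard)
    have h2 := ciSup_le (h.upper_bound_preserved hy hle hui)
    linarith
  · have hcard' : N - N / 2 ≤
        (univ.filter fun i => -u + (u - b) / 2 ≤ (-y) (τ 0) i).card := by
      have hsplit := card_filter_add_card_filter_not (s := (univ : Finset (Fin N)))
        (fun i => b + (u - b) / 2 ≤ y (τ 0) i)
      have hsub : (univ.filter fun i => ¬ b + (u - b) / 2 ≤ y (τ 0) i) ⊆
          univ.filter fun i => -u + (u - b) / 2 ≤ (-y) (τ 0) i := by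
        intro i hi
        have := not_le.1 (mem_filter.1 hi).2
        refine mem_filter.2 ⟨mem_univ i, ?_⟩
        simp only [Pi.neg_apply]
        linarith
      have := card_le_card hsub
      rw [card_univ, Fintype.card_fin] at hsplit
      omega
    have h1 := h.lower_bound_of_windows hN2 (neg_flow hy) hτ hS (b := -u) (α := (u - b) / 2)
      (by linarith) (fun i => neg_le_neg (hui i)) hcard'
    have h2 := le_ciInf (h.lower_bound_preserved hy hle hbi)
    have h3 : ⨆ i, y (τ (N / 2)) i ≤
        u - (4 * N * max K (((N : ℝ) - 1) / γ))⁻¹ ^ (N / 2) * ((u - b) / 2) := by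
      refine ciSup_le fun i => ?_
      have := h1 i
      simp only [Pi.neg_apply] at this
      linarith
    linarith

variable (hN : 0 < N)

lemma exists_tendsto_sortedState (h : IsCutBalanced γ K B) (hN2 : 2 ≤ N)
    (hy : ∀ t i, y (t + 1) i = ∑ j, B t i j * y t j) :
    (∀ n ≤ N, ∃ d, Tendsto (fun k => IsSortedFlow.lowSum (max K (((N : ℝ) - 1) / γ))
      (sortedState hN y k) n) atTop (nhds d)) ∧
    ∀ i < N, ∃ d, Tendsto (fun k => sortedState hN y k i) atTop (nhds d) := by
  have hf := h.isSortedFlow hN hy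
  set M := max K (((N : ℝ) - 1) / γ)
  have hlow : ∀ n ≤ N, ∃ d, Tendsto (fun k => IsSortedFlow.lowSum M (sortedState hN y k) n)
      atTop (nhds d) := by
    intro n hn
    refine ⟨_, tendsto_atTop_ciSup (hf.lowSum_monotone hN2 hn)
      ⟨∑ i ∈ range n, M⁻¹ ^ i * sortedState hN y 0 (N - 1), ?_⟩⟩
    rintro _ ⟨k, rfl⟩
    exact sum_le_sum fun i _ => mul_le_mul_of_nonneg_left
      (h.upper_bound_preserved hy (Nat.zero_le k) (le_sortedState_last hN y 0) _)
      (hf.pow_inv_pos i).le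
  refine ⟨hlow, fun i hi => ?_⟩
  obtain ⟨d, hd⟩ := hlow i hi.le
  obtain ⟨d', hd'⟩ := hlow (i + 1) hi
  refine ⟨(M⁻¹ ^ i)⁻¹ * (d' - d), ((hd'.sub hd).const_mul _).congr fun k => ?_⟩
  rw [IsSortedFlow.lowSum, sum_range_succ, IsSortedFlow.lowSum, add_sub_cancel_left,
    inv_mul_cancel_left₀ (hf.pow_inv_pos i).ne']

/-- A limiting gap in the sorted state makes the inflow below the gap summable. -/
lemma summable_inflow_of_gap (h : IsCutBalanced γ K B) (hN2 : 2 ≤ N)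
    (hy : ∀ t i, y (t + 1) i = ∑ j, B t i j * y t j) {n : ℕ} (hn : 0 < n) (hnN : n < N)
    {c d : ℝ} (hc : Tendsto (fun k => sortedState hN y k (n - 1)) atTop (nhds c))
    (hd : Tendsto (fun k => sortedState hN y k n) atTop (nhds d)) (hcd : c < d) :
    Summable fun k => IsSortedFlow.inflow N (sortedWeights hN B y k) n := by
  have hf := h.isSortedFlow hN hy
  obtain ⟨D, hD⟩ := (h.exists_tendsto_sortedState hN hN2 hy).1 n hnN.le
  set M := max K (((N : ℝ) - 1) / γ)
  obtain ⟨T, hT⟩ := eventually_atTop.1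
    ((hd.sub hc).eventually (lt_mem_nhds (by linarith : (d - c) / 2 < d - c)))
  have hx : 0 < M⁻¹ ^ (n - 1) * ((d - c) / 2) :=
    mul_pos (hf.pow_inv_pos _) (by linarith)
  rw [← summable_nat_add_iff T]
  refine summable_of_sum_range_le (c := (M⁻¹ ^ (n - 1) * ((d - c) / 2))⁻¹ *
    (D - IsSortedFlow.lowSum M (sortedState hN y T) n))
    (fun k => hf.inflow_nonneg _ _) fun k => ?_
  rw [le_inv_mul_iff₀ hx]
  have h1 := hf.sum_inflow_mul_le hn hnN (Nat.le_add_right T k)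
    (fun j hj => (hT j (mem_Ico.1 hj).1).le)
  rw [sum_Ico_eq_sum_range, Nat.add_sub_cancel_left] at h1
  have h2 := (hf.lowSum_monotone hN2 hnN.le).ge_of_tendsto hD (T + k)
  simp only [add_comm _ T]
  linarith

lemma not_tendsto_sum_of_eventually_le {f g : ℕ → ℝ} (hf : ∀ k, 0 ≤ f k) (hg : Summable g)
    (hfg : ∀ᶠ k in atTop, f k ≤ g k) :
    ¬ Tendsto (fun n => ∑ t ∈ range n, f t) atTop atTop := by
  have hs : Summable f := hg.of_norm_bounded_eventually_nat
    (hfg.mono fun k hk => by rwa [Real.norm_of_nonneg (hf k)])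
  exact not_tendsto_atTop_of_tendsto_nhds hs.hasSum.tendsto_sum_nat

/-- Under a limiting gap the lower nodes are eventually a fixed set, with no persistent arc between
it and its complement. -/
lemma exists_isolated_of_gap (h : IsCutBalanced γ K B) (hN2 : 2 ≤ N)
    (hy : ∀ t i, y (t + 1) i = ∑ j, B t i j * y t j) {n : ℕ} (hn : 0 < n) (hnN : n < N)
    {c d : ℝ} (hc : Tendsto (fun k => sortedState hN y k (n - 1)) atTop (nhds c))
    (hd : Tendsto (fun k => sortedState hN y k n) atTop (nhds d)) (hcd : c < d) :
    ∃ L : Finset (Fin N), L.Nonempty ∧ L ≠ univ ∧ ∀ p q : Fin N,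
      Tendsto (fun n => ∑ t ∈ range n, B t q p) atTop atTop → (p ∈ L ↔ q ∈ L) := by
  have hsum := h.summable_inflow_of_gap hN hN2 hy hn hnN hc hd hcd
  obtain ⟨T, hT⟩ := eventually_atTop.1
    (hsum.tendsto_atTop_zero.eventually (gt_mem_nhds h.pos))
  have hconst : ∀ k ≥ T, lowSet hN (y k) n = lowSet hN (y T) n := by
    intro k hk
    induction k, hk using Nat.le_induction with
    | base => rfl
    | succ k hk ih =>
      rw [← ih]
      by_contra hne
      have hlt := hT k hk
      rw [inflow_sortedWeights hN y k hnN.le] at hlt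
      exact hlt.not_ge (h.diag_le_of_ne k
        (by rw [card_lowSet hN _ hnN.le, card_lowSet hN _ hnN.le]) hne)
  set L := lowSet hN (y T) n
  have hin : ∀ k ≥ T, IsSortedFlow.inflow N (sortedWeights hN B y k) n =
      ∑ i ∈ L, ∑ j ∈ Lᶜ, B k i j := fun k hk => by
    rw [inflow_sortedWeights hN y k hnN.le, hconst k hk, hconst (k + 1) (by omega)]
  have hLne : L.Nonempty := lowSet_nonempty hN _ hn
  have hLuniv : L ≠ univ := lowSet_ne_univ hN _ hnN
  have hentry : ∀ (S : Finset (Fin N)) (k : ℕ) (p q : Fin N), q ∈ S → p ∉ S →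
      B k q p ≤ ∑ i ∈ S, ∑ j ∈ Sᶜ, B k i j := fun S k p q hq hp =>
    (single_le_sum (f := fun j => B k q j) (fun j _ => h.nonneg k q j) (mem_compl.2 hp)).trans
      (single_le_sum (f := fun i => ∑ j ∈ Sᶜ, B k i j)
        (fun i _ => sum_nonneg fun j _ => h.nonneg k i j) hq)
  refine ⟨L, hLne, hLuniv, fun p q hpq => ?_⟩
  by_contra hiff
  rcases (by tauto : (p ∉ L ∧ q ∈ L) ∨ (p ∈ L ∧ q ∉ L)) with ⟨hp, hq⟩ | ⟨hp, hq⟩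
  · refine not_tendsto_sum_of_eventually_le (fun k => h.nonneg k q p) hsum ?_ hpq
    filter_upwards [eventually_ge_atTop T] with k hk
    rw [hin k hk]
    exact hentry L k p q hq hp
  · refine not_tendsto_sum_of_eventually_le (fun k => h.nonneg k q p) (hsum.mul_left K) ?_ hpq
    filter_upwards [eventually_ge_atTop T] with k hk
    rw [hin k hk]
    have := hentry Lᶜ k p q (mem_compl.2 hq) (by simpa using hp)
    rw [compl_compl] at this
    exact this.trans (h.cut k L hLne hLuniv)

lemma consensus (h : IsCutBalanced γ K B) (hN2 : 2 ≤ N)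
    (hy : ∀ t i, y (t + 1) i = ∑ j, B t i j * y t j)
    (hst : ∃ r : Fin N, ∀ i : Fin N, Relation.ReflTransGen
      (fun p q : Fin N => Tendsto (fun n => ∑ t ∈ Finset.range n, B t q p) atTop atTop) r i) :
    ∃ c : ℝ, ∀ i, Tendsto (fun t => y t i) atTop (nhds c) := by
  have hN : 0 < N := by omega
  have hf := h.isSortedFlow hN hy
  choose! W hW using (h.exists_tendsto_sortedState hN hN2 hy).2
  have hstep : ∀ n, 0 < n → n < N → W n = W (n - 1) := by
    intro n hn hnN
    have hle : W (n - 1) ≤ W n :=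
      le_of_tendsto_of_tendsto' (hW _ (by omega)) (hW n hnN) fun k => hf.mono k (Nat.sub_le n 1)
    refine le_antisymm (not_lt.1 fun hlt => ?_) hle
    obtain ⟨L, ⟨l, hl⟩, hLuniv, hL⟩ :=
      h.exists_isolated_of_gap hN hN2 hy hn hnN (hW _ (by omega)) (hW n hnN) hlt
    obtain ⟨r, hr⟩ := hst
    have hmem : ∀ i, r ∈ L ↔ i ∈ L := fun i => by
      induction hr i with
      | refl => rfl
      | tail _ harc ih => exact ih.trans (hL _ _ harc)
    exact hLuniv (eq_univ_iff_forall.2 fun i => (hmem i).1 ((hmem l).2 hl))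
  have hconst : ∀ n < N, W n = W 0 := by
    intro n
    induction n with
    | zero => exact fun _ => rfl
    | succ n ih => exact fun hn => (hstep (n + 1) (by omega) hn).trans (ih (by omega))
  refine ⟨W 0, fun i => tendsto_of_tendsto_of_tendsto_of_le_of_le (hW 0 hN) ?_
    (fun k => sortedState_zero_le hN y k i) (fun k => le_sortedState_last hN y k i)⟩
  rw [← hconst (N - 1) (by omega)]
  exact hW (N - 1) (by omega)

end IsCutBalanced

theorem stmt16 (N : ℕ) (hN : 2 ≤ N) (γ : ℝ) (hγ : 0 < γ) (Mst : ℝ) (hMst : 1 ≤ Mst)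
    (B : ℕ → Matrix (Fin N) (Fin N) ℝ)
    (hnonneg : ∀ t i j, 0 ≤ B t i j)
    (hrow : ∀ t i, ∑ j, B t i j = 1)
    (hdiag : ∀ t i, γ ≤ B t i i)
    (hcut : ∀ t : ℕ, ∀ S : Finset (Fin N), S.Nonempty → S ≠ Finset.univ →
      ∑ i ∈ Sᶜ, ∑ j ∈ S, B t i j ≤ Mst * ∑ i ∈ S, ∑ j ∈ Sᶜ, B t i j)
    (hst : ∃ r : Fin N, ∀ i : Fin N, Relation.ReflTransGen
      (fun p q : Fin N => Tendsto (fun n => ∑ t ∈ Finset.range n, B t q p) atTop atTop) r i) :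
    ∀ y : ℕ → Fin N → ℝ,
      (∀ t i, y (t + 1) i = ∑ j, B t i j * y t j) →
      (∃ c : ℝ, ∀ i, Tendsto (fun t => y t i) atTop (nhds c)) ∧
        (∀ s t : ℕ, ∀ τ : ℕ → ℕ, τ 0 = s → τ (N / 2) = t →
          (∀ q < N / 2, τ q < τ (q + 1)) →
          (∀ q < N / 2, ∀ S : ℕ → Finset (Fin N),
            (∀ k, τ q ≤ k → k ≤ τ (q + 1) → (S k).Nonempty ∧ S k ≠ Finset.univ) →
            (∀ k, τ q ≤ k → k ≤ τ (q + 1) → (S k).card = (S (τ q)).card) →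
            1 ≤ ∑ k ∈ Finset.Ico (τ q) (τ (q + 1)), ∑ i ∈ (S (k + 1))ᶜ, ∑ j ∈ S k, B k i j) →
          (⨆ i, y t i) - (⨅ i, y t i) ≤
            (1 - ((max Mst (((N : ℝ) - 1) / γ)) ^ (N / 2))⁻¹ / (8 * (N : ℝ) ^ 2) ^ (N / 2)) *
              ((⨆ i, y s i) - (⨅ i, y s i))) := by
  have h : IsCutBalanced γ Mst B := ⟨hγ, hMst, hnonneg, hrow, hdiag, hcut⟩
  intro y hy
  refine ⟨h.consensus hN hy hst, ?_⟩
  rintro s t τ rfl rfl hτ hS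
  exact h.contraction hN hy hτ hS
end
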